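/- arXiv:1105.2709 — 6 statements merged into one kernel-verified Lean document; each statement's English description precedes it below -/
import Mathlib

section
/- Let n, m ≥ 1 and let φ_1, …, φ_k ∈ ℂ^n and ψ_1, …, ψ_k ∈ ℂ^m be arbitrary vectors with k < m + n − 1. Then there exist nonzero f ∈ ℂ^n and g ∈ ℂ^m such that the product vector f ⊗ g is orthogonal to φ_i ⊗ ψ_i for every i = 1, …, k. In particular, no family of fewer than m + n − 1 product vectors in ℂ^n ⊗ ℂ^m is a general Unextendible Product Basis. -/
open scoped ComplexConjugate

/-- The standard Hermitian inner product, conjugate-linear in the first argument. -/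
noncomputable def hinner {α : Type*} [Fintype α] (x y : α → ℂ) : ℂ :=
  ∑ a, conj (x a) * y a

/-- The product vector `φ ⊗ ψ` in `ℂ^n ⊗ ℂ^m`, identified with `Fin n × Fin m → ℂ`. -/
noncomputable def prodVec {n m : ℕ} (φ : Fin n → ℂ) (ψ : Fin m → ℂ) :
    Fin n × Fin m → ℂ :=
  fun p => φ p.1 * ψ p.2

theorem hinner_prodVec {n m : ℕ} (φ f : Fin n → ℂ) (ψ g : Fin m → ℂ) :
    hinner (prodVec φ ψ) (prodVec f g) = hinner φ f * hinner ψ g := by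
  simp only [hinner, prodVec, Fintype.sum_prod_type, Finset.sum_mul_sum, map_mul]
  exact Finset.sum_congr rfl fun _ _ => Finset.sum_congr rfl fun _ _ => by ring

/-- Fewer than `dim ℂ^α` vectors have a common nonzero orthogonal vector. -/
theorem exists_ne_zero_hinner_eq_zero {ι α : Type*} [Fintype ι] [Fintype α]
    (h : Fintype.card ι < Fintype.card α) (v : ι → α → ℂ) :
    ∃ f : α → ℂ, f ≠ 0 ∧ ∀ i, hinner (v i) f = 0 := by
  let A : Matrix ι α ℂ := fun i a => conj (v i a)
  have hker : LinearMap.ker A.mulVecLin ≠ ⊥ :=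
    LinearMap.ker_ne_bot_of_finrank_lt (by simpa using h)
  obtain ⟨f, hf, hf0⟩ := Submodule.exists_mem_ne_zero_of_ne_bot hker
  exact ⟨f, hf0, fun i => congrFun (LinearMap.mem_ker.mp hf) i⟩

theorem stmt0 (n m k : ℕ) (hn : 1 ≤ n) (hm : 1 ≤ m) (hk : k < m + n - 1)
    (φ : Fin k → Fin n → ℂ) (ψ : Fin k → Fin m → ℂ) :
    ∃ (f : Fin n → ℂ) (g : Fin m → ℂ), f ≠ 0 ∧ g ≠ 0 ∧
      ∀ i, hinner (prodVec (φ i) (ψ i)) (prodVec f g) = 0 := by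
  have hcard : Fintype.card {i : Fin k // i.val < n - 1} ≤ n - 1 := by
    simpa using Fintype.card_le_of_injective
      (fun i : {i : Fin k // i.val < n - 1} => (⟨i.1.val, i.2⟩ : Fin (n - 1)))
      fun i j hij => Subtype.ext (Fin.ext (Fin.mk.inj hij))
  have hcard' : Fintype.card {i : Fin k // ¬ i.val < n - 1} ≤ m - 1 := by
    simpa using Fintype.card_le_of_injective
      (fun i : {i : Fin k // ¬ i.val < n - 1} =>
        (⟨i.1.val - (n - 1), by omega⟩ : Fin (m - 1)))
      fun i j hij => by
        have := congrArg Fin.val hij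
        have hi := i.2
        have hj := j.2
        exact Subtype.ext (Fin.ext (by dsimp only at this; omega))
  obtain ⟨f, hf, hφ⟩ := exists_ne_zero_hinner_eq_zero
    (α := Fin n) (by rw [Fintype.card_fin]; omega)
    fun i : {i : Fin k // i.val < n - 1} => φ i
  obtain ⟨g, hg, hψ⟩ := exists_ne_zero_hinner_eq_zero
    (α := Fin m) (by rw [Fintype.card_fin]; omega)
    fun i : {i : Fin k // ¬ i.val < n - 1} => ψ i
  refine ⟨f, g, hf, hg, fun i => ?_⟩
  rw [hinner_prodVec]
  by_cases hi : i.val < n - 1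
  · rw [hφ ⟨i, hi⟩, zero_mul]
  · rw [hψ ⟨i, hi⟩, mul_zero]
end

section
/- Let n, m ≥ 1 and let φ_1, …, φ_{m+n−1} ∈ ℂ^n and ψ_1, …, ψ_{m+n−1} ∈ ℂ^m be nonzero vectors. The family {φ_i ⊗ ψ_i}_{i=1}^{m+n−1} is a general Unextendible Product Basis in ℂ^n ⊗ ℂ^m (i.e., no nonzero product vector f ⊗ g is orthogonal to all of them) if and only if every n-element subfamily of {φ_i}_{i=1}^{m+n−1} is linearly independent and every m-element subfamily of {ψ_i}_{i=1}^{m+n−1} is linearly independent. -/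
open scoped ComplexConjugate

/-- Fewer than `n` vectors of `ℂ^n` have a common nonzero orthogonal vector. -/
theorem exists_ne_zero_hinner_eq_zero_of_card_lt {ι : Type*} {n : ℕ} (v : ι → Fin n → ℂ)
    (S : Finset ι) (hS : S.card < n) :
    ∃ f : Fin n → ℂ, f ≠ 0 ∧ ∀ i ∈ S, hinner (v i) f = 0 := by
  let M : Matrix S (Fin n) ℂ := .of fun i a => conj (v i a)
  have hker : LinearMap.ker M.mulVecLin ≠ ⊥ :=
    LinearMap.ker_ne_bot_of_finrank_lt (by simpa using hS)
  obtain ⟨f, hf, hf0⟩ := (Submodule.ne_bot_iff _).1 hker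
  exact ⟨f, hf0, fun i hi => congrFun (LinearMap.mem_ker.1 hf) ⟨i, hi⟩⟩

/-- A family of `n` vectors of `ℂ^n` is linearly independent iff no nonzero vector is orthogonal
to all of them. -/
theorem linearIndependent_iff_not_exists_hinner_eq_zero {ι : Type*} {n : ℕ}
    (v : ι → Fin n → ℂ) (S : Finset ι) (hS : S.card = n) :
    LinearIndependent ℂ (fun i : {x // x ∈ S} => v i.1) ↔
      ¬ ∃ f : Fin n → ℂ, f ≠ 0 ∧ ∀ i ∈ S, hinner (v i) f = 0 := by
  let e := (S.equivFinOfCardEq hS).symm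
  let V : Matrix (Fin n) (Fin n) ℂ := .of fun k => v (e k)
  have hV : LinearIndependent ℂ (fun i : {x // x ∈ S} => v i.1) ↔ V.det ≠ 0 := by
    rw [← linearIndependent_equiv e, ← isUnit_iff_ne_zero, ← Matrix.isUnit_iff_isUnit_det,
      ← Matrix.linearIndependent_rows_iff_isUnit]
    rfl
  have hdet : V.conjTranspose.transpose.det = 0 ↔ V.det = 0 := by
    rw [Matrix.det_transpose, Matrix.det_conjTranspose, star_eq_zero]
  rw [hV, ne_eq, ← hdet, ← Matrix.exists_mulVec_eq_zero_iff, not_iff_not]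
  refine exists_congr fun f => and_congr_right fun _ => ⟨fun h i hi => ?_, fun h => ?_⟩
  · obtain ⟨k, hk⟩ := e.surjective ⟨i, hi⟩
    have hk' := congrFun h k
    change hinner (v (e k)) f = 0 at hk'
    rwa [hk] at hk'
  · funext k
    exact h (e k) (e k).2

theorem stmt1 (n m : ℕ) (hn : 1 ≤ n) (hm : 1 ≤ m)
    (φ : Fin (m + n - 1) → Fin n → ℂ) (ψ : Fin (m + n - 1) → Fin m → ℂ)
    (hφ : ∀ i, φ i ≠ 0) (hψ : ∀ i, ψ i ≠ 0) :
    (¬ ∃ (f : Fin n → ℂ) (g : Fin m → ℂ), f ≠ 0 ∧ g ≠ 0 ∧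
        ∀ i, hinner (prodVec (φ i) (ψ i)) (prodVec f g) = 0) ↔
      ((∀ S : Finset (Fin (m + n - 1)), S.card = n →
          LinearIndependent ℂ (fun i : {x // x ∈ S} => φ i.1)) ∧
       (∀ S : Finset (Fin (m + n - 1)), S.card = m →
          LinearIndependent ℂ (fun i : {x // x ∈ S} => ψ i.1))) := by
  simp only [hinner_prodVec, mul_eq_zero]
  constructor
  · intro h
    refine ⟨fun S hS => ?_, fun S hS => ?_⟩
    · rw [linearIndependent_iff_not_exists_hinner_eq_zero φ S hS]
      rintro ⟨f, hf0, hf⟩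
      obtain ⟨g, hg0, hg⟩ := exists_ne_zero_hinner_eq_zero_of_card_lt ψ Sᶜ
        (by rw [Finset.card_compl, Fintype.card_fin]; omega)
      refine h ⟨f, g, hf0, hg0, fun i => ?_⟩
      by_cases hi : i ∈ S
      · exact .inl (hf i hi)
      · exact .inr (hg i (Finset.mem_compl.2 hi))
    · rw [linearIndependent_iff_not_exists_hinner_eq_zero ψ S hS]
      rintro ⟨g, hg0, hg⟩
      obtain ⟨f, hf0, hf⟩ := exists_ne_zero_hinner_eq_zero_of_card_lt φ Sᶜ
        (by rw [Finset.card_compl, Fintype.card_fin]; omega)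
      refine h ⟨f, g, hf0, hg0, fun i => ?_⟩
      by_cases hi : i ∈ S
      · exact .inr (hg i hi)
      · exact .inl (hf i (Finset.mem_compl.2 hi))
  · rintro ⟨h₁, h₂⟩ ⟨f, g, hf0, hg0, h⟩
    classical
    let A : Finset (Fin (m + n - 1)) := {i | hinner (φ i) f = 0}
    have hA : A.card + Aᶜ.card = m + n - 1 := by
      rw [Finset.card_add_card_compl, Fintype.card_fin]
    obtain hn' | hm' : n ≤ A.card ∨ m ≤ Aᶜ.card := by omega
    · obtain ⟨S, hSA, hS⟩ := Finset.exists_subset_card_eq hn'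
      exact (linearIndependent_iff_not_exists_hinner_eq_zero φ S hS).1 (h₁ S hS)
        ⟨f, hf0, fun i hi => (Finset.mem_filter.1 (hSA hi)).2⟩
    · obtain ⟨S, hSA, hS⟩ := Finset.exists_subset_card_eq hm'
      refine (linearIndependent_iff_not_exists_hinner_eq_zero ψ S hS).1 (h₂ S hS)
        ⟨g, hg0, fun i hi => (h i).resolve_left fun hi' => ?_⟩
      exact Finset.mem_compl.1 (hSA hi) (Finset.mem_filter.2 ⟨Finset.mem_univ i, hi'⟩)
end

section
/- Let n, m ≥ 1, let N ≥ m + n − 1, and let φ_1, …, φ_N ∈ ℂ^n and ψ_1, …, ψ_N ∈ ℂ^m be nonzero vectors. The family {φ_i ⊗ ψ_i}_{i=1}^N is a general Unextendible Product Basis in ℂ^n ⊗ ℂ^m if and only if for every pair of subsets 𝒩, ℳ ⊆ {1, …, N} with 𝒩 ∩ ℳ = ∅ and 𝒩 ∪ ℳ = {1, …, N}, at least one of the following holds: the vectors {φ_i : i ∈ 𝒩} span ℂ^n, or the vectors {ψ_j : j ∈ ℳ} span ℂ^m. -/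
open scoped ComplexConjugate

open scoped ComplexOrder in
theorem hinner_self_eq_zero {α : Type*} [Fintype α] {f : α → ℂ} : hinner f f = 0 ↔ f = 0 :=
  dotProduct_star_self_eq_zero

/-- A family fails to span exactly when some nonzero vector is orthogonal to all of it. -/
theorem span_ne_top_iff_exists_hinner_eq_zero {α : Type*} [Fintype α] (S : Set (α → ℂ)) :
    Submodule.span ℂ S ≠ ⊤ ↔ ∃ f : α → ℂ, f ≠ 0 ∧ ∀ x ∈ S, hinner x f = 0 := by
  classical
  constructor
  · intro h
    obtain ⟨L, hL, hle⟩ := Submodule.exists_le_ker_of_lt_top _ (lt_top_iff_ne_top.2 h)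
    have key (x : α → ℂ) : hinner x (fun a => conj (L fun j => if a = j then 1 else 0)) = conj (L x) := by
      rw [LinearMap.pi_apply_eq_sum_univ L x]
      simp [hinner]
    refine ⟨fun a => conj (L fun j => if a = j then 1 else 0), fun h0 => hL (LinearMap.ext fun x => ?_),
      fun x hx => ?_⟩
    · have := key x
      rw [h0] at this
      exact (map_eq_zero (starRingEnd ℂ)).1 (this.symm.trans (by simp [hinner]))
    · rw [key, LinearMap.mem_ker.1 (hle (Submodule.subset_span hx)), map_zero]
  · rintro ⟨f, hf, hS⟩ htop
    refine hf (hinner_self_eq_zero.1 ?_)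
    have hmem : f ∈ Submodule.span ℂ S := htop ▸ Submodule.mem_top
    suffices ∀ x ∈ Submodule.span ℂ S, hinner x f = 0 from this f hmem
    intro x hx
    induction hx using Submodule.span_induction with
    | mem x hx => exact hS x hx
    | zero => simp [hinner]
    | add x y _ _ hx hy =>
      simp only [hinner] at hx hy ⊢
      simp [add_mul, Finset.sum_add_distrib, hx, hy]
    | smul c x _ hx =>
      simp only [hinner] at hx ⊢
      simp [mul_assoc, ← Finset.mul_sum, hx]

theorem stmt3 (n m N : ℕ) (hn : 1 ≤ n) (hm : 1 ≤ m) (hN : m + n - 1 ≤ N)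
    (φ : Fin N → Fin n → ℂ) (ψ : Fin N → Fin m → ℂ)
    (hφ : ∀ i, φ i ≠ 0) (hψ : ∀ i, ψ i ≠ 0) :
    (¬ ∃ (f : Fin n → ℂ) (g : Fin m → ℂ), f ≠ 0 ∧ g ≠ 0 ∧
        ∀ i, hinner (prodVec (φ i) (ψ i)) (prodVec f g) = 0) ↔
      (∀ 𝒩 ℳ : Finset (Fin N), Disjoint 𝒩 ℳ → 𝒩 ∪ ℳ = Finset.univ →
        Submodule.span ℂ (φ '' ↑𝒩) = ⊤ ∨ Submodule.span ℂ (ψ '' ↑ℳ) = ⊤) := by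
  classical
  simp only [hinner_prodVec, mul_eq_zero]
  rw [← not_iff_not, not_not]
  push Not
  simp only [span_ne_top_iff_exists_hinner_eq_zero, Set.forall_mem_image, Finset.mem_coe]
  constructor
  · rintro ⟨f, g, hf, hg, h⟩
    refine ⟨Finset.univ.filter fun i => hinner (φ i) f = 0,
      Finset.univ.filter fun i => ¬ hinner (φ i) f = 0,
      Finset.disjoint_filter_filter_not _ _ _, Finset.filter_union_filter_not_eq _ _,
      ⟨f, hf, fun i hi => (Finset.mem_filter.1 hi).2⟩,
      ⟨g, hg, fun i hi => (h i).resolve_left (Finset.mem_filter.1 hi).2⟩⟩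
  · rintro ⟨𝒩, ℳ, -, hunion, ⟨f, hf, hfN⟩, ⟨g, hg, hgM⟩⟩
    refine ⟨f, g, hf, hg, fun i => ?_⟩
    have hi : i ∈ 𝒩 ∪ ℳ := hunion ▸ Finset.mem_univ i
    exact (Finset.mem_union.1 hi).imp (fun h => hfN h) fun h => hgM h
end

section
/- Let ρ be a PPT state on ℂ^n ⊗ ℂ^m and suppose the product vector φ ⊗ ψ lies in the kernel of ρ, i.e., ρ(φ ⊗ ψ) = 0. Then for all φ' ∈ ℂ^n and ψ' ∈ ℂ^m one has ⟨φ' ⊗ ψ, ρ(φ ⊗ ψ')⟩ = 0 and ⟨φ ⊗ ψ', ρ(φ' ⊗ ψ)⟩ = 0. -/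
open scoped ComplexConjugate ComplexOrder

/-- The partial transpose with respect to the first subsystem:
`ρ^{T1}((i,j),(k,l)) = ρ((k,j),(i,l))`. -/
noncomputable def pt {n m : ℕ} (ρ : Matrix (Fin n × Fin m) (Fin n × Fin m) ℂ) :
    Matrix (Fin n × Fin m) (Fin n × Fin m) ℂ :=
  Matrix.of fun a b => ρ (b.1, a.2) (a.1, b.2)

theorem hinner_eq_dotProduct {α : Type*} [Fintype α] (x y : α → ℂ) :
    hinner x y = star x ⬝ᵥ y := rfl

theorem hinner_mulVec_prodVec_eq_pt {n m : ℕ}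
    (ρ : Matrix (Fin n × Fin m) (Fin n × Fin m) ℂ)
    (a c : Fin n → ℂ) (b d : Fin m → ℂ) :
    hinner (prodVec a b) (ρ.mulVec (prodVec c d)) =
      hinner (prodVec (star c) b) ((pt ρ).mulVec (prodVec (star a) d)) := by
  have key (σ : Matrix (Fin n × Fin m) (Fin n × Fin m) ℂ)
      (a c : Fin n → ℂ) (b d : Fin m → ℂ) :
      hinner (prodVec a b) (σ.mulVec (prodVec c d)) =
        ∑ i, ∑ k, ∑ j, ∑ l, conj (a i) * conj (b j) * (σ (i, j) (k, l) * (c k * d l)) := by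
    simp only [hinner, prodVec, Matrix.mulVec, dotProduct, Fintype.sum_prod_type,
      Finset.mul_sum, map_mul]
    exact Finset.sum_congr rfl fun i _ => Finset.sum_comm
  rw [key, key, Finset.sum_comm]
  refine Finset.sum_congr rfl fun k _ => Finset.sum_congr rfl fun i _ =>
    Finset.sum_congr rfl fun j _ => Finset.sum_congr rfl fun l _ => ?_
  simp only [pt, Matrix.of_apply, Pi.star_apply, RCLike.star_def, Complex.conj_conj]
  ring

theorem Matrix.IsHermitian.star_hinner_mulVec {α : Type*} [Fintype α] {A : Matrix α α ℂ}
    (hA : A.IsHermitian) (x y : α → ℂ) :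
    star (hinner x (A.mulVec y)) = hinner y (A.mulVec x) := by
  rw [hinner_eq_dotProduct, hinner_eq_dotProduct, Matrix.star_dotProduct, star_star,
    Matrix.star_mulVec, hA.eq, Matrix.dotProduct_mulVec]

theorem stmt6 (n m : ℕ) (ρ : Matrix (Fin n × Fin m) (Fin n × Fin m) ℂ)
    (hne : ρ ≠ 0) (hpsd : ρ.PosSemidef) (hppt : (pt ρ).PosSemidef)
    (φ : Fin n → ℂ) (ψ : Fin m → ℂ) (hker : ρ.mulVec (prodVec φ ψ) = 0) :
    ∀ (φ' : Fin n → ℂ) (ψ' : Fin m → ℂ),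
      hinner (prodVec φ' ψ) (ρ.mulVec (prodVec φ ψ')) = 0 ∧
      hinner (prodVec φ ψ') (ρ.mulVec (prodVec φ' ψ)) = 0 := by
  intro φ' ψ'
  have hpt : (pt ρ).mulVec (prodVec (star φ) ψ) = 0 := by
    rw [← hppt.dotProduct_mulVec_zero_iff, ← hinner_eq_dotProduct,
      ← hinner_mulVec_prodVec_eq_pt, hker, hinner_eq_dotProduct, dotProduct_zero]
  have h : hinner (prodVec φ ψ') (ρ.mulVec (prodVec φ' ψ)) = 0 := by
    rw [hinner_mulVec_prodVec_eq_pt, hpt, hinner_eq_dotProduct, dotProduct_zero]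
  refine ⟨?_, h⟩
  rw [← hpsd.isHermitian.star_hinner_mulVec, h, star_zero]
end

section
/- Let ρ be a PPT state on ℂ^3 ⊗ ℂ^3, let φ, φ' ∈ ℂ^3 and ψ, ψ' ∈ ℂ^3, and suppose that ρ(φ ⊗ ψ) = 0 and ρ(φ ⊗ ψ' + φ' ⊗ ψ) = 0. Then ρ(φ ⊗ ψ') = 0 and ρ(φ' ⊗ ψ) = 0. -/
open scoped ComplexConjugate ComplexOrder

open Matrix in
/-- Matrix elements between product vectors: partial transposition exchanges the first factors
and conjugates them. -/
theorem star_prodVec_dotProduct_mulVec_eq_pt {n m : ℕ}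
    (ρ : Matrix (Fin n × Fin m) (Fin n × Fin m) ℂ) (a c : Fin n → ℂ) (b d : Fin m → ℂ) :
    star (prodVec a b) ⬝ᵥ ρ *ᵥ prodVec c d =
      star (prodVec (star c) b) ⬝ᵥ pt ρ *ᵥ prodVec (star a) d := by
  simp only [dotProduct, mulVec, prodVec, pt, Pi.star_apply, Fintype.sum_prod_type,
    Finset.mul_sum, of_apply, star_mul', star_star]
  calc _ = ∑ i, ∑ k, ∑ j, ∑ l, star (a i) * star (b j) * (ρ (i, j) (k, l) * (c k * d l)) :=
        Finset.sum_congr rfl fun i _ => Finset.sum_comm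
    _ = ∑ k, ∑ i, ∑ j, ∑ l, star (a i) * star (b j) * (ρ (i, j) (k, l) * (c k * d l)) :=
        Finset.sum_comm
    _ = _ := by
        refine Finset.sum_congr rfl fun k _ => ?_
        rw [Finset.sum_comm]
        refine Finset.sum_congr rfl fun j _ => Finset.sum_congr rfl fun i _ =>
          Finset.sum_congr rfl fun l _ => ?_
        ring

open Matrix in
/-- If a PPT matrix annihilates `φ ⊗ ψ`, then its partial transpose annihilates
`conj φ ⊗ ψ`. -/
theorem pt_mulVec_prodVec_star_eq_zero {n m : ℕ}
    {ρ : Matrix (Fin n × Fin m) (Fin n × Fin m) ℂ} (hppt : (pt ρ).PosSemidef)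
    {φ : Fin n → ℂ} {ψ : Fin m → ℂ} (h : ρ *ᵥ prodVec φ ψ = 0) :
    pt ρ *ᵥ prodVec (star φ) ψ = 0 := by
  rw [← hppt.dotProduct_mulVec_zero_iff, ← star_prodVec_dotProduct_mulVec_eq_pt, h,
    dotProduct_zero]

theorem stmt7 (ρ : Matrix (Fin 3 × Fin 3) (Fin 3 × Fin 3) ℂ)
    (hne : ρ ≠ 0) (hpsd : ρ.PosSemidef) (hppt : (pt ρ).PosSemidef)
    (φ φ' ψ ψ' : Fin 3 → ℂ)
    (h1 : ρ.mulVec (prodVec φ ψ) = 0)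
    (h2 : ρ.mulVec (prodVec φ ψ' + prodVec φ' ψ) = 0) :
    ρ.mulVec (prodVec φ ψ') = 0 ∧ ρ.mulVec (prodVec φ' ψ) = 0 := by
  rw [Matrix.mulVec_add] at h2
  have hcross : star (prodVec φ ψ') ⬝ᵥ ρ.mulVec (prodVec φ' ψ) = 0 := by
    rw [star_prodVec_dotProduct_mulVec_eq_pt, pt_mulVec_prodVec_star_eq_zero hppt h1,
      dotProduct_zero]
  have h3 : ρ.mulVec (prodVec φ ψ') = 0 := by
    rw [← hpsd.dotProduct_mulVec_zero_iff, eq_neg_of_add_eq_zero_left h2, dotProduct_neg,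
      hcross, neg_zero]
  exact ⟨h3, by rwa [h3, zero_add] at h2⟩
end

section
/- Let ρ be a non-separable PPT state of rank 4 on ℂ^3 ⊗ ℂ^3. Then there are exactly six product vectors in the kernel of ρ up to scalar multiples: there exist nonzero product vectors z_1, …, z_6 in ker ρ, pairwise non-proportional, such that every nonzero product vector in ker ρ is a complex scalar multiple of one of z_1, …, z_6. -/
open scoped ComplexConjugate ComplexOrder

/-- `ρ` is separable if it is a finite sum of projections `z z^*` onto product vectors. -/
def Separable {n m : ℕ} (ρ : Matrix (Fin n × Fin m) (Fin n × Fin m) ℂ) : Prop :=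
  ∃ (k : ℕ) (φ : Fin k → Fin n → ℂ) (ψ : Fin k → Fin m → ℂ),
    ρ = ∑ t, Matrix.vecMulVec (prodVec (φ t) (ψ t)) (star (prodVec (φ t) (ψ t)))

/-- `z` is a product vector. -/
def IsProd {n m : ℕ} (z : Fin n × Fin m → ℂ) : Prop :=
  ∃ (φ : Fin n → ℂ) (ψ : Fin m → ℂ), z = prodVec φ ψ

section

open Matrix
open scoped Kronecker

section

variable {n m n' m' : ℕ}

theorem prodVec_add_left (φ φ' : Fin n → ℂ) (ψ : Fin m → ℂ) :
    prodVec (φ + φ') ψ = prodVec φ ψ + prodVec φ' ψ := by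
  funext p; simp [prodVec, add_mul]

theorem prodVec_add_right (φ : Fin n → ℂ) (ψ ψ' : Fin m → ℂ) :
    prodVec φ (ψ + ψ') = prodVec φ ψ + prodVec φ ψ' := by
  funext p; simp [prodVec, mul_add]

theorem prodVec_smul_left (c : ℂ) (φ : Fin n → ℂ) (ψ : Fin m → ℂ) :
    prodVec (c • φ) ψ = c • prodVec φ ψ := by
  funext p; simp [prodVec, mul_assoc]

theorem prodVec_smul_right (c : ℂ) (φ : Fin n → ℂ) (ψ : Fin m → ℂ) :
    prodVec φ (c • ψ) = c • prodVec φ ψ := by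
  funext p; simp [prodVec, mul_left_comm]

theorem prodVec_ne_zero {φ : Fin n → ℂ} {ψ : Fin m → ℂ} (hφ : φ ≠ 0) (hψ : ψ ≠ 0) :
    prodVec φ ψ ≠ 0 := by
  obtain ⟨i, hi⟩ := Function.ne_iff.1 hφ
  obtain ⟨j, hj⟩ := Function.ne_iff.1 hψ
  exact Function.ne_iff.2 ⟨(i, j), mul_ne_zero hi hj⟩

theorem kronecker_mulVec_prodVec (P : Matrix (Fin n') (Fin n) ℂ) (Q : Matrix (Fin m') (Fin m) ℂ)
    (φ : Fin n → ℂ) (ψ : Fin m → ℂ) :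
    (P ⊗ₖ Q) *ᵥ prodVec φ ψ = prodVec (P *ᵥ φ) (Q *ᵥ ψ) := by
  funext p
  simp only [mulVec, dotProduct, prodVec, kroneckerMap_apply, Fintype.sum_prod_type,
    Finset.sum_mul_sum]
  exact Finset.sum_congr rfl fun i _ => Finset.sum_congr rfl fun j _ => by ring

/-- The projection onto the line of a product vector, up to normalisation. -/
noncomputable def prodProj (φ : Fin n → ℂ) (ψ : Fin m → ℂ) :
    Matrix (Fin n × Fin m) (Fin n × Fin m) ℂ :=
  vecMulVec (prodVec φ ψ) (star (prodVec φ ψ))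

theorem prodProj_apply (φ : Fin n → ℂ) (ψ : Fin m → ℂ) (a b : Fin n × Fin m) :
    prodProj φ ψ a b = φ a.1 * ψ a.2 * (conj (φ b.1) * conj (ψ b.2)) := by
  simp [prodProj, vecMulVec_apply, prodVec]

theorem separable_sum {ι : Type*} (s : Finset ι) (φ : ι → Fin n → ℂ) (ψ : ι → Fin m → ℂ) :
    Separable (∑ t ∈ s, prodProj (φ t) (ψ t)) := by
  refine ⟨s.card, fun k => φ (s.equivFin.symm k), fun k => ψ (s.equivFin.symm k), ?_⟩
  rw [← Finset.sum_coe_sort]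
  exact (Equiv.sum_comp s.equivFin.symm (fun t : s => prodProj (φ t) (ψ t))).symm

theorem separable_prodProj (φ : Fin n → ℂ) (ψ : Fin m → ℂ) : Separable (prodProj φ ψ) := by
  simpa using separable_sum {()} (fun _ => φ) (fun _ => ψ)

theorem Separable.add {ρ σ : Matrix (Fin n × Fin m) (Fin n × Fin m) ℂ} (hρ : Separable ρ)
    (hσ : Separable σ) : Separable (ρ + σ) := by
  obtain ⟨k, φ, ψ, rfl⟩ := hρ
  obtain ⟨l, φ', ψ', rfl⟩ := hσ
  have := separable_sum Finset.univ (Sum.elim φ φ') (Sum.elim ψ ψ')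
  rw [Fintype.sum_sum_type] at this
  exact this

theorem separable_zero : Separable (0 : Matrix (Fin n × Fin m) (Fin n × Fin m) ℂ) :=
  ⟨0, fun _ => 0, fun _ => 0, by simp⟩

theorem Separable.sum {ι : Type*} (s : Finset ι)
    {ρ : ι → Matrix (Fin n × Fin m) (Fin n × Fin m) ℂ} (h : ∀ t ∈ s, Separable (ρ t)) :
    Separable (∑ t ∈ s, ρ t) :=
  Finset.sum_induction _ Separable (fun _ _ => Separable.add) separable_zero h

/-- Additive maps sending product projections to separable states preserve separability. -/
theorem Separable.map {ρ : Matrix (Fin n × Fin m) (Fin n × Fin m) ℂ} (hρ : Separable ρ)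
    (f : Matrix (Fin n × Fin m) (Fin n × Fin m) ℂ →+
      Matrix (Fin n' × Fin m') (Fin n' × Fin m') ℂ)
    (hf : ∀ φ ψ, Separable (f (prodProj φ ψ))) : Separable (f ρ) := by
  obtain ⟨k, φ, ψ, rfl⟩ := hρ
  rw [map_sum]
  exact Separable.sum _ fun t _ => hf _ _

theorem Separable.congr_kronecker {ρ : Matrix (Fin n × Fin m) (Fin n × Fin m) ℂ}
    (hρ : Separable ρ) (P : Matrix (Fin n) (Fin n') ℂ) (Q : Matrix (Fin m) (Fin m') ℂ) :
    Separable ((P ⊗ₖ Q)ᴴ * ρ * (P ⊗ₖ Q)) := by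
  refine hρ.map ⟨⟨fun ρ => (P ⊗ₖ Q)ᴴ * ρ * (P ⊗ₖ Q), by simp⟩,
    by intros; simp [Matrix.mul_add, Matrix.add_mul]⟩ fun φ ψ => ?_
  show Separable ((P ⊗ₖ Q)ᴴ * prodProj φ ψ * (P ⊗ₖ Q))
  convert separable_prodProj (Pᴴ *ᵥ φ) (Qᴴ *ᵥ ψ) using 1
  rw [prodProj, prodProj, ← kronecker_mulVec_prodVec, ← conjTranspose_kronecker, mul_vecMulVec,
    vecMulVec_mul, star_mulVec, conjTranspose_conjTranspose]

theorem Separable.smul {ρ : Matrix (Fin n × Fin m) (Fin n × Fin m) ℂ} (hρ : Separable ρ)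
    {r : ℝ} (hr : 0 ≤ r) : Separable ((r : ℂ) • ρ) := by
  refine hρ.map (DistribSMul.toAddMonoidHom _ (r : ℂ)) fun φ ψ => ?_
  convert separable_prodProj ((Real.sqrt r : ℂ) • φ) ψ using 1
  ext a b
  have : (r : ℂ) = (Real.sqrt r : ℂ) * (Real.sqrt r : ℂ) := by
    rw [← Complex.ofReal_mul, Real.mul_self_sqrt hr]
  simp only [DistribSMul.toAddMonoidHom_apply, Matrix.smul_apply, prodProj_apply, Pi.smul_apply,
    smul_eq_mul, map_mul, Complex.conj_ofReal]
  rw [this]; ring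

/-! ### Partial transposition -/

theorem pt_add (ρ σ : Matrix (Fin n × Fin m) (Fin n × Fin m) ℂ) : pt (ρ + σ) = pt ρ + pt σ := rfl

theorem pt_sub (ρ σ : Matrix (Fin n × Fin m) (Fin n × Fin m) ℂ) : pt (ρ - σ) = pt ρ - pt σ := rfl

theorem pt_smul (c : ℂ) (ρ : Matrix (Fin n × Fin m) (Fin n × Fin m) ℂ) :
    pt (c • ρ) = c • pt ρ := rfl

theorem pt_conjTranspose (ρ : Matrix (Fin n × Fin m) (Fin n × Fin m) ℂ) : pt ρᴴ = (pt ρ)ᴴ := rfl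

theorem pt_sum {ι : Type*} (s : Finset ι) (ρ : ι → Matrix (Fin n × Fin m) (Fin n × Fin m) ℂ) :
    pt (∑ t ∈ s, ρ t) = ∑ t ∈ s, pt (ρ t) := by
  ext a b; simp [pt, Matrix.sum_apply]

theorem pt_prodProj (φ : Fin n → ℂ) (ψ : Fin m → ℂ) :
    pt (prodProj φ ψ) = prodProj (star φ) ψ := by
  ext a b; simp [pt, prodProj_apply]; ring

theorem Separable.pt {ρ : Matrix (Fin n × Fin m) (Fin n × Fin m) ℂ} (hρ : Separable ρ) :
    Separable (pt ρ) :=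
  hρ.map ⟨⟨_root_.pt, rfl⟩, fun _ _ => rfl⟩ fun φ ψ => by
    show Separable (_root_.pt (prodProj φ ψ))
    rw [pt_prodProj]
    exact separable_prodProj _ _

theorem pt_kronecker_congr (ρ : Matrix (Fin n × Fin m) (Fin n × Fin m) ℂ)
    (P : Matrix (Fin n) (Fin n') ℂ) (Q : Matrix (Fin m) (Fin m') ℂ) :
    pt ((P ⊗ₖ Q)ᴴ * ρ * (P ⊗ₖ Q)) = (P.map star ⊗ₖ Q)ᴴ * pt ρ * (P.map star ⊗ₖ Q) := by
  ext a b
  simp only [pt, of_apply, mul_apply, conjTranspose_apply, kroneckerMap_apply,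
    map_apply, Fintype.sum_prod_type, star_mul', star_star, Finset.sum_mul]
  have key (F : Fin n → Fin m → Fin n → Fin m → ℂ) :
      ∑ x, ∑ y, ∑ z, ∑ w, F x y z w = ∑ x, ∑ y, ∑ z, ∑ w, F z y x w := by
    rw [Finset.sum_comm]
    conv_rhs => rw [Finset.sum_comm]
    exact Finset.sum_congr rfl fun y _ => Finset.sum_comm
  rw [key]
  exact Finset.sum_congr rfl fun i _ => Finset.sum_congr rfl fun j _ =>
    Finset.sum_congr rfl fun k _ => Finset.sum_congr rfl fun l _ => by ring

/-- Both the state and its partial transpose are positive semidefinite. -/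
def PPT (ρ : Matrix (Fin n × Fin m) (Fin n × Fin m) ℂ) : Prop :=
  ρ.PosSemidef ∧ (pt ρ).PosSemidef

theorem PPT.congr_kronecker {ρ : Matrix (Fin n × Fin m) (Fin n × Fin m) ℂ}
    (hρ : PPT ρ) (P : Matrix (Fin n) (Fin n') ℂ) (Q : Matrix (Fin m) (Fin m') ℂ) :
    PPT ((P ⊗ₖ Q)ᴴ * ρ * (P ⊗ₖ Q)) :=
  ⟨hρ.1.conjTranspose_mul_mul_same _, by
    rw [pt_kronecker_congr]; exact hρ.2.conjTranspose_mul_mul_same _⟩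

theorem PPT.pt {ρ : Matrix (Fin n × Fin m) (Fin n × Fin m) ℂ} (hρ : PPT ρ) : PPT (pt ρ) :=
  ⟨hρ.2, hρ.1⟩

/-! ### Exchanging the two factors -/

/-- Exchange of the two tensor factors. -/
def swapState (ρ : Matrix (Fin n × Fin m) (Fin n × Fin m) ℂ) :
    Matrix (Fin m × Fin n) (Fin m × Fin n) ℂ :=
  ρ.submatrix Prod.swap Prod.swap

theorem Separable.swap {ρ : Matrix (Fin n × Fin m) (Fin n × Fin m) ℂ} (hρ : Separable ρ) :
    Separable (swapState ρ) :=
  hρ.map ⟨⟨swapState, rfl⟩, fun _ _ => rfl⟩ fun φ ψ => by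
    convert separable_prodProj ψ φ using 1
    ext a b
    show prodProj φ ψ a.swap b.swap = _
    simp [prodProj_apply]; ring

theorem PPT.swap {ρ : Matrix (Fin n × Fin m) (Fin n × Fin m) ℂ} (hρ : PPT ρ) :
    PPT (swapState ρ) :=
  ⟨hρ.1.submatrix _, (hρ.2.submatrix (Prod.swap : Fin m × Fin n → _)).transpose⟩

end

section

variable {n m n' m' : ℕ} {ι : Type*} [Fintype ι]

/-- Every PPT state on `ℂ^n ⊗ ℂ^m` is separable. -/
def AllSep (n m : ℕ) : Prop :=
  ∀ ⦃ρ : Matrix (Fin n × Fin m) (Fin n × Fin m) ℂ⦄, PPT ρ → Separable ρ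

theorem AllSep.swap (h : AllSep n m) : AllSep m n := fun _ hρ => (h hρ.swap).swap

theorem dotProduct_prodVec (a : Fin n → ℂ) (b : Fin m → ℂ) (x : Fin n → ℂ) (y : Fin m → ℂ) :
    prodVec a b ⬝ᵥ prodVec x y = (a ⬝ᵥ x) * (b ⬝ᵥ y) := by
  simp only [dotProduct, prodVec, Fintype.sum_prod_type, Finset.sum_mul_sum]
  exact Finset.sum_congr rfl fun i _ => Finset.sum_congr rfl fun j _ => by ring

theorem star_prodVec (x : Fin n → ℂ) (y : Fin m → ℂ) :
    star (prodVec x y) = prodVec (star x) (star y) := by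
  funext p; simp [prodVec]

theorem prodVec_single (i : Fin n) (j : Fin m) :
    prodVec (Pi.single i 1) (Pi.single j 1) = Pi.single (i, j) 1 := by
  funext p
  obtain ⟨a, b⟩ := p
  simp only [prodVec, Pi.single_apply, Prod.mk.injEq]
  split_ifs <;> simp_all

/-- A vector is determined by its pairings with product vectors. -/
theorem eq_of_forall_dotProduct_prodVec {v w : Fin n × Fin m → ℂ}
    (h : ∀ x y, prodVec x y ⬝ᵥ v = prodVec x y ⬝ᵥ w) : v = w := by
  funext p
  obtain ⟨i, j⟩ := p
  simpa [prodVec_single] using h (Pi.single i 1) (Pi.single j 1)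

theorem dotProduct_pt_mulVec (ρ : Matrix (Fin n × Fin m) (Fin n × Fin m) ℂ)
    (x x' : Fin n → ℂ) (y y' : Fin m → ℂ) :
    prodVec x y ⬝ᵥ (pt ρ *ᵥ prodVec x' y') = prodVec x' y ⬝ᵥ (ρ *ᵥ prodVec x y') := by
  simp only [dotProduct, mulVec, pt, of_apply, prodVec, Fintype.sum_prod_type, Finset.mul_sum]
  rw [Finset.sum_comm]
  conv_rhs => rw [Finset.sum_comm]
  refine Finset.sum_congr rfl fun j _ => ?_
  rw [Finset.sum_comm]
  exact Finset.sum_congr rfl fun i _ => Finset.sum_congr rfl fun k _ =>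
    Finset.sum_congr rfl fun l _ => by ring

theorem star_dotProduct_mulVec (C : Matrix ι (Fin n × Fin m) ℂ) (v w : Fin n × Fin m → ℂ) :
    star v ⬝ᵥ ((Cᴴ * C) *ᵥ w) = star (C *ᵥ v) ⬝ᵥ (C *ᵥ w) := by
  rw [← mulVec_mulVec, dotProduct_mulVec, star_mulVec]

theorem star_mulVec_dotProduct_pt (C : Matrix ι (Fin n × Fin m) ℂ) (x φ : Fin n → ℂ)
    (y ψ : Fin m → ℂ) :
    prodVec x (star y) ⬝ᵥ (pt (Cᴴ * C) *ᵥ prodVec (star φ) ψ) =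
      star (C *ᵥ prodVec φ y) ⬝ᵥ (C *ᵥ prodVec x ψ) := by
  rw [dotProduct_pt_mulVec, ← star_prodVec, star_dotProduct_mulVec]

/-- If `φ ⊗ ψ` is in the kernel of a PPT state, then `φ̄ ⊗ ψ` is in the kernel of its partial
transpose; this is expressed as an orthogonality relation. -/
theorem PPT.orthogonal {C : Matrix ι (Fin n × Fin m) ℂ} (hC : PPT (Cᴴ * C)) {φ : Fin n → ℂ}
    {ψ : Fin m → ℂ} (h : C *ᵥ prodVec φ ψ = 0) (x : Fin n → ℂ) (y : Fin m → ℂ) :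
    star (C *ᵥ prodVec φ y) ⬝ᵥ (C *ᵥ prodVec x ψ) = 0 := by
  have h0 : star (prodVec (star φ) ψ) ⬝ᵥ (_root_.pt (Cᴴ * C) *ᵥ prodVec (star φ) ψ) = 0 := by
    rw [star_prodVec, star_star, star_mulVec_dotProduct_pt, h, dotProduct_zero]
  rw [hC.2.dotProduct_mulVec_zero_iff] at h0
  rw [← star_mulVec_dotProduct_pt, h0, dotProduct_zero]

/-- A PPT state killing `φ₀ ⊗ ℂ^m` lives on a smaller space. -/
theorem separable_of_kernel_left (hN : AllSep n m)
    {τ : Matrix (Fin (n + 1) × Fin m) (Fin (n + 1) × Fin m) ℂ} (hτ : PPT τ)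
    {φ : Fin (n + 1) → ℂ} (hφ : φ ≠ 0) (h : ∀ y, τ *ᵥ prodVec φ y = 0) : Separable τ := by
  obtain ⟨i, hi⟩ := Function.ne_iff.1 hφ
  replace hi : φ i ≠ 0 := hi
  let F : Matrix (Fin n) (Fin (n + 1)) ℂ :=
    of fun k j => (if j = i.succAbove k then 1 else 0) -
      if j = i then φ (i.succAbove k) / φ i else 0
  let P : Matrix (Fin (n + 1)) (Fin n) ℂ := of fun j k => if j = i.succAbove k then 1 else 0
  have hPF (x : Fin (n + 1) → ℂ) : (P * F) *ᵥ x = x - (x i / φ i) • φ := by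
    have hF (k : Fin n) : (F *ᵥ x) k = x (i.succAbove k) - φ (i.succAbove k) / φ i * x i := by
      simp [F, mulVec, dotProduct, sub_mul, ite_mul]
    have hP (v : Fin n → ℂ) (k : Fin n) : (P *ᵥ v) (i.succAbove k) = v k := by
      simp [P, mulVec, dotProduct]
    have hP0 (v : Fin n → ℂ) : (P *ᵥ v) i = 0 := by
      simp [P, mulVec, dotProduct]
    rw [← mulVec_mulVec]
    funext j
    refine Fin.succAboveCases i ?_ (fun k => ?_) j
    · simp [hP0, hi]
    · rw [hP, hF, Pi.sub_apply, Pi.smul_apply, smul_eq_mul]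
      ring
  have hmul : τ * ((P * F) ⊗ₖ (1 : Matrix (Fin m) (Fin m) ℂ)) = τ := by
    ext a ⟨j, k⟩
    have := congrFun (congrArg (τ *ᵥ ·)
      (kronecker_mulVec_prodVec (P * F) (1 : Matrix (Fin m) (Fin m) ℂ)
        (Pi.single j 1) (Pi.single k 1))) a
    rw [hPF, one_mulVec, sub_eq_add_neg, prodVec_add_left, ← neg_smul, prodVec_smul_left,
      mulVec_add, mulVec_smul, h, smul_zero, add_zero, prodVec_single, mulVec_mulVec,
      mulVec_single_one, mulVec_single_one] at this
    exact this
  have hmul' : ((P * F) ⊗ₖ (1 : Matrix (Fin m) (Fin m) ℂ))ᴴ * τ = τ := by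
    have := congrArg conjTranspose hmul
    rwa [conjTranspose_mul, hτ.1.1.eq] at this
  have hK : (P * F) ⊗ₖ (1 : Matrix (Fin m) (Fin m) ℂ) =
      (P ⊗ₖ (1 : Matrix (Fin m) (Fin m) ℂ)) * (F ⊗ₖ (1 : Matrix (Fin m) (Fin m) ℂ)) := by
    rw [← mul_kronecker_mul, Matrix.mul_one]
  have := (hN (hτ.congr_kronecker P 1)).congr_kronecker F (1 : Matrix (Fin m) (Fin m) ℂ)
  rwa [show (F ⊗ₖ (1 : Matrix (Fin m) (Fin m) ℂ))ᴴ *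
      ((P ⊗ₖ (1 : Matrix (Fin m) (Fin m) ℂ))ᴴ * τ * (P ⊗ₖ (1 : Matrix (Fin m) (Fin m) ℂ))) *
      (F ⊗ₖ (1 : Matrix (Fin m) (Fin m) ℂ)) = τ by
    rw [hK, conjTranspose_mul] at hmul'
    rw [hK] at hmul
    simp only [Matrix.mul_assoc] at hmul hmul' ⊢
    rw [hmul, hmul']] at this

/-- Splitting off product vectors: if `C (φ₀ ⊗ ·)` is spanned by orthonormal vectors `f k` such
that each `f k† C` is a product functional `h k ⊗ g k`, then the remaining state lives on a smaller
space. -/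
theorem separable_of_split [DecidableEq ι] (hN : AllSep n m) {C : Matrix ι (Fin (n + 1) × Fin m) ℂ}
    (hC : PPT (Cᴴ * C)) {φ : Fin (n + 1) → ℂ} (hφ : φ ≠ 0) {κ : ℕ} (f : Fin κ → ι → ℂ)
    (ψ g : Fin κ → Fin m → ℂ) (h : Fin κ → Fin (n + 1) → ℂ)
    (hf : ∀ k l, star (f k) ⬝ᵥ f l = if k = l then 1 else 0)
    (hψ : ∀ k, C *ᵥ prodVec φ (ψ k) = f k) (hh : ∀ k, h k ⬝ᵥ φ = 1)
    (ha : ∀ y, C *ᵥ prodVec φ y = ∑ k, (g k ⬝ᵥ y) • f k)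
    (hb : ∀ x y k, star (f k) ⬝ᵥ (C *ᵥ prodVec x y) = (h k ⬝ᵥ x) * (g k ⬝ᵥ y)) :
    Separable (Cᴴ * C) := by
  have hgψ (k l) : g k ⬝ᵥ ψ l = if k = l then 1 else 0 := by
    rw [← hf, ← hψ l, hb, hh, one_mul]
  let E : Matrix ι ι ℂ := 1 - ∑ k, vecMulVec (f k) (star (f k))
  have hrow (k) : star (f k) ᵥ* C = prodVec (h k) (g k) := by
    refine eq_of_forall_dotProduct_prodVec fun x y => ?_
    rw [dotProduct_comm, ← dotProduct_mulVec, hb, dotProduct_prodVec, dotProduct_comm x,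
      dotProduct_comm y]
  have hcol (k) : Cᴴ *ᵥ f k = prodVec (star (h k)) (star (g k)) := by
    rw [← star_prodVec, ← hrow, star_vecMul, star_star]
  have hEf (k) : E *ᵥ f k = 0 := by
    simp [E, sub_mulVec, sum_mulVec, vecMulVec_mulVec, hf]
  have hEH : Eᴴ = E := by
    simp [E, conjTranspose_sum, conjTranspose_vecMulVec]
  have hEE : Eᴴ * E = E := by
    rw [hEH]
    conv_lhs => enter [2]; simp only [E]
    simp [Matrix.mul_sub, Matrix.mul_sum, mul_vecMulVec, hEf]
  let τ := Cᴴ * C - ∑ k, prodProj (star (h k)) (star (g k))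
  have hτE : τ = (E * C)ᴴ * (E * C) := by
    rw [conjTranspose_mul, Matrix.mul_assoc, ← Matrix.mul_assoc Eᴴ, hEE]
    simp only [E, τ, Matrix.sub_mul, Matrix.mul_sub, Matrix.one_mul, Matrix.sum_mul,
      Matrix.mul_sum, vecMulVec_mul, mul_vecMulVec, hrow, hcol, prodProj, star_prodVec, star_star]
  have hw (k) : pt (Cᴴ * C) *ᵥ prodVec (star φ) (ψ k) = prodVec (h k) (star (g k)) := by
    refine eq_of_forall_dotProduct_prodVec fun x y => ?_
    obtain ⟨y, rfl⟩ : ∃ y', y = star y' := ⟨star y, by simp⟩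
    rw [star_mulVec_dotProduct_pt, ha, star_sum, sum_dotProduct, dotProduct_prodVec]
    simp only [star_smul, smul_dotProduct, hb, hgψ]
    simp [← star_dotProduct_star, dotProduct_comm, mul_comm]
  have hptτ : pt τ = pt (Cᴴ * C) - ∑ k, prodProj (h k) (star (g k)) := by
    simp only [τ, pt_sub, pt_sum, pt_prodProj, star_star]
  let Lt : Matrix (Fin (n + 1) × Fin m) (Fin (n + 1) × Fin m) ℂ :=
    1 - ∑ k, vecMulVec (prodVec (star φ) (ψ k)) (prodVec (star (h k)) (g k))
  have h1 : pt (Cᴴ * C) * Lt = pt τ := by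
    rw [hptτ]
    simp only [Lt, Matrix.mul_sub, Matrix.mul_one, Matrix.mul_sum, mul_vecMulVec, hw, prodProj,
      star_prodVec, star_star]
  have hker (k) : pt τ *ᵥ prodVec (star φ) (ψ k) = 0 := by
    have hsφ (l) : star (h l) ⬝ᵥ star φ = 1 := by
      rw [star_dotProduct_star, dotProduct_comm, hh, star_one]
    rw [hptτ, sub_mulVec, hw, sum_mulVec]
    simp only [prodProj, vecMulVec_mulVec, star_prodVec, star_star, dotProduct_prodVec, hsφ, hgψ]
    simp
  have hHerm : (pt τ)ᴴ = pt τ := by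
    rw [← pt_conjTranspose, hτE, conjTranspose_mul, conjTranspose_conjTranspose]
  have h2 : Ltᴴ * pt τ = pt τ := by
    rw [← hHerm, ← conjTranspose_mul, hHerm]
    simp [Lt, Matrix.mul_sub, Matrix.mul_sum, mul_vecMulVec, hker, hHerm]
  have hτ : PPT τ := by
    refine ⟨hτE ▸ posSemidef_conjTranspose_mul_self _, ?_⟩
    rw [← h2, ← h1, ← Matrix.mul_assoc]
    exact hC.2.conjTranspose_mul_mul_same _
  have hsep : Separable τ := by
    refine separable_of_kernel_left hN hτ hφ fun y => ?_
    rw [hτE, ← mulVec_mulVec, ← mulVec_mulVec, ha, mulVec_sum]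
    simp [mulVec_smul, hEf]
  rw [show Cᴴ * C = τ + ∑ k, prodProj (star (h k)) (star (g k)) by simp [τ]]
  exact hsep.add (Separable.sum _ fun k _ => separable_prodProj _ _)

end

variable {n m n' m' : ℕ} {ι κ : Type*} [Fintype ι] [Fintype κ]

/-! ### Slices of a bilinear map -/

/-- The matrix of `y ↦ C (x ⊗ y)`. -/
noncomputable def rSlice (C : Matrix ι (Fin n × Fin m) ℂ) (x : Fin n → ℂ) : Matrix ι (Fin m) ℂ :=
  of fun k j => ∑ i, C k (i, j) * x i

/-- The matrix of `x ↦ C (x ⊗ y)`. -/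
noncomputable def lSlice (C : Matrix ι (Fin n × Fin m) ℂ) (y : Fin m → ℂ) : Matrix ι (Fin n) ℂ :=
  of fun k i => ∑ j, C k (i, j) * y j

theorem rSlice_mulVec {α : Type*} (C : Matrix α (Fin n × Fin m) ℂ) (x : Fin n → ℂ) (y : Fin m → ℂ) :
    rSlice C x *ᵥ y = C *ᵥ prodVec x y := by
  funext k
  simp only [rSlice, mulVec, dotProduct, of_apply, prodVec, Fintype.sum_prod_type, Finset.sum_mul]
  rw [Finset.sum_comm]
  exact Finset.sum_congr rfl fun i _ => Finset.sum_congr rfl fun j _ => by ring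

theorem lSlice_mulVec {α : Type*} (C : Matrix α (Fin n × Fin m) ℂ) (x : Fin n → ℂ) (y : Fin m → ℂ) :
    lSlice C y *ᵥ x = C *ᵥ prodVec x y := by
  funext k
  simp only [lSlice, mulVec, dotProduct, of_apply, prodVec, Fintype.sum_prod_type, Finset.sum_mul]
  exact Finset.sum_congr rfl fun i _ => Finset.sum_congr rfl fun j _ => by ring

theorem star_dotProduct_self_eq (v : ι → ℂ) :
    star v ⬝ᵥ v = ((∑ i, ‖v i‖ ^ 2 : ℝ) : ℂ) := by
  simp only [dotProduct, Pi.star_apply, RCLike.star_def, Complex.conj_mul', Complex.ofReal_sum,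
    Complex.ofReal_pow]

theorem exists_normalization {v : ι → ℂ} (hv : v ≠ 0) :
    ∃ r : ℂ, r ≠ 0 ∧ star (r • v) ⬝ᵥ (r • v) = 1 := by
  have hs : (0 : ℝ) < ∑ i, ‖v i‖ ^ 2 := by
    obtain ⟨i, hi⟩ := Function.ne_iff.1 hv
    exact Finset.sum_pos' (fun _ _ => by positivity)
      ⟨i, Finset.mem_univ _, pow_pos (norm_pos_iff.2 hi) 2⟩
  set s : ℝ := ∑ i, ‖v i‖ ^ 2
  have hs' : ((Real.sqrt s : ℝ) : ℂ) * (Real.sqrt s : ℝ) = s := by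
    rw [← Complex.ofReal_mul, Real.mul_self_sqrt hs.le]
  have hs0 : ((Real.sqrt s : ℝ) : ℂ) ≠ 0 := by
    exact_mod_cast (Real.sqrt_pos.2 hs).ne'
  refine ⟨((Real.sqrt s : ℝ) : ℂ)⁻¹, inv_ne_zero hs0, ?_⟩
  rw [star_smul, smul_dotProduct, dotProduct_smul, star_dotProduct_self_eq, ← hs']
  simp only [RCLike.star_def, map_inv₀, Complex.conj_ofReal, smul_eq_mul]
  field_simp

/-- If `C (φ ⊗ ·)` has rank at most one then `φ` can be split off. -/
theorem separable_of_rank_le_one [DecidableEq ι] (hN : AllSep n m)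
    {C : Matrix ι (Fin (n + 1) × Fin m) ℂ} (hC : PPT (Cᴴ * C)) {φ : Fin (n + 1) → ℂ} (hφ : φ ≠ 0)
    (h : ∃ f : ι → ℂ, ∀ y, ∃ a : ℂ, C *ᵥ prodVec φ y = a • f) : Separable (Cᴴ * C) := by
  by_cases h0 : ∀ y, C *ᵥ prodVec φ y = 0
  · exact separable_of_kernel_left hN hC hφ fun y => by rw [← mulVec_mulVec, h0, mulVec_zero]
  push Not at h0
  obtain ⟨y, hy⟩ := h0
  obtain ⟨r, hr, hr1⟩ := exists_normalization hy
  set f : ι → ℂ := r • C *ᵥ prodVec φ y with hf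
  have hψ : C *ᵥ prodVec φ (r • y) = f := by rw [prodVec_smul_right, mulVec_smul]
  have hspan (z) : C *ᵥ prodVec φ z = (star f ⬝ᵥ C *ᵥ prodVec φ z) • f := by
    obtain ⟨f₀, hf₀⟩ := h
    obtain ⟨a, ha⟩ := hf₀ y
    obtain ⟨b, hb⟩ := hf₀ z
    have ha0 : a ≠ 0 := by rintro rfl; exact hy (by rw [ha, zero_smul])
    have : C *ᵥ prodVec φ z = (b / (a * r)) • f := by
      rw [hf, ha, hb, smul_smul, smul_smul]
      congr 1
      field_simp
    rw [this, dotProduct_smul, hr1, smul_eq_mul, mul_one]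
  have hg (z) : (star f ᵥ* rSlice C φ) ⬝ᵥ z = star f ⬝ᵥ C *ᵥ prodVec φ z := by
    rw [← dotProduct_mulVec, rSlice_mulVec]
  have hh (x) : (star f ᵥ* lSlice C (r • y)) ⬝ᵥ x = star f ⬝ᵥ C *ᵥ prodVec x (r • y) := by
    rw [← dotProduct_mulVec, lSlice_mulVec]
  refine separable_of_split hN hC hφ (κ := 1) (fun _ => f) (fun _ => r • y)
    (fun _ => star f ᵥ* rSlice C φ) (fun _ => star f ᵥ* lSlice C (r • y)) ?_ (fun _ => hψ) ?_ ?_ ?_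
  · intro k l
    rw [hr1, if_pos (Subsingleton.elim k l)]
  · intro k
    rw [hh, hψ, hr1]
  · intro z
    rw [Fin.sum_univ_one, hg, ← hspan]
  · intro x z _
    rw [hg, hh]
    set c := star f ⬝ᵥ C *ᵥ prodVec φ z
    have hk : C *ᵥ prodVec φ (z + (-c) • (r • y)) = 0 := by
      rw [prodVec_add_right, mulVec_add, hspan z, prodVec_smul_right, mulVec_smul, hψ, neg_smul,
        add_neg_cancel]
    have := hC.orthogonal hk x (r • y)
    rw [hψ, prodVec_add_right, mulVec_add, prodVec_smul_right, mulVec_smul, dotProduct_add,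
      dotProduct_smul, smul_eq_mul] at this
    linear_combination this

/-! ### Spectral decompositions -/

theorem Matrix.IsHermitian.exists_unitary_diagonal [DecidableEq ι] {A : Matrix ι ι ℂ}
    (hA : A.IsHermitian) : ∃ U : Matrix ι ι ℂ, Uᴴ * U = 1 ∧ U * Uᴴ = 1 ∧
      A = U * diagonal (fun i => (hA.eigenvalues i : ℂ)) * Uᴴ :=
  ⟨hA.eigenvectorUnitary, by simp [← star_eq_conjTranspose], by simp [← star_eq_conjTranspose], by
    conv_lhs => rw [hA.spectral_theorem]
    rw [Unitary.conjStarAlgAut_apply]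
    rfl⟩

/-- A positive semidefinite matrix factors as `Cᴴ C` with `C` surjective. -/
theorem Matrix.PosSemidef.exists_factorization [DecidableEq ι] {ρ : Matrix ι ι ℂ}
    (hρ : ρ.PosSemidef) : ∃ (C : Matrix (Fin ρ.rank) ι ℂ) (R : Matrix ι (Fin ρ.rank) ℂ),
      ρ = Cᴴ * C ∧ C * R = 1 := by
  obtain ⟨U, hU, -, h⟩ := hρ.1.exists_unitary_diagonal
  set l := hρ.1.eigenvalues
  have hl (i) : 0 ≤ l i := hρ.eigenvalues_nonneg i
  let e : Fin ρ.rank ≃ {i // l i ≠ 0} := Fintype.equivOfCardEq (by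
    rw [Fintype.card_fin, hρ.1.rank_eq_card_non_zero_eigs])
  refine ⟨of fun k j => (Real.sqrt (l (e k)) : ℂ) * Uᴴ (e k) j,
    of fun j k => U j (e k) * (Real.sqrt (l (e k)) : ℂ)⁻¹, ?_, ?_⟩
  · ext a b
    conv_lhs => rw [h, mul_apply]
    simp_rw [mul_diagonal]
    simp only [mul_apply, conjTranspose_apply, of_apply, star_mul', star_star]
    rw [Equiv.sum_comp e fun i : {i // l i ≠ 0} => star (Real.sqrt (l i) : ℂ) * U a i *
        ((Real.sqrt (l i) : ℂ) * star (U b i)),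
      ← Finset.sum_filter_of_ne (p := fun i => l i ≠ 0) (by
        intro i _ hi h0
        simp [h0] at hi),
      Finset.sum_subtype _ (p := fun i => l i ≠ 0) (by simp)]
    refine Finset.sum_congr rfl fun i _ => ?_
    have : (l i : ℂ) = (Real.sqrt (l i) : ℂ) * (Real.sqrt (l i) : ℂ) := by
      rw [← Complex.ofReal_mul, Real.mul_self_sqrt (hl i)]
    rw [this, RCLike.star_def, Complex.conj_ofReal]
    ring
  · ext k k'
    have hk := congrFun (congrFun hU (e k)) (e k')
    have h0 : ((Real.sqrt (l (e k')) : ℝ) : ℂ) ≠ 0 := by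
      exact_mod_cast (Real.sqrt_pos.2 ((hl _).lt_of_ne' (e k').2)).ne'
    calc _ = (Real.sqrt (l (e k)) : ℂ) * (Uᴴ * U) (e k) (e k') * (Real.sqrt (l (e k')) : ℂ)⁻¹ := by
          simp only [mul_apply, of_apply, Finset.mul_sum, Finset.sum_mul]
          exact Finset.sum_congr rfl fun _ _ => by ring
      _ = _ := by
          rw [hk, one_apply, one_apply]
          by_cases hkk : k = k'
          · subst hkk
            simp [h0]
          · have : (e k : ι) ≠ e k' := fun h => hkk (e.injective (Subtype.ext h))
            simp [hkk, this]

/-! ### Decomposing non-extreme states -/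

theorem Matrix.IsHermitian.exists_diagonal_sub [DecidableEq ι] {T : Matrix ι ι ℂ}
    (hT : T.IsHermitian) (r : ℝ) : ∃ U : Matrix ι ι ℂ,
      T - (r : ℂ) • 1 = U * diagonal (fun i => ((hT.eigenvalues i - r : ℝ) : ℂ)) * Uᴴ := by
  obtain ⟨U, -, hU', h⟩ := hT.exists_unitary_diagonal
  refine ⟨U, ?_⟩
  have h1 : diagonal (fun i => ((hT.eigenvalues i - r : ℝ) : ℂ)) =
      diagonal (fun i => (hT.eigenvalues i : ℂ)) - (r : ℂ) • 1 := by
    rw [smul_one_eq_diagonal, diagonal_sub]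
    simp only [Complex.ofReal_sub]
  rw [h1, Matrix.mul_sub, Matrix.sub_mul, ← h, Matrix.mul_smul, Matrix.smul_mul, Matrix.mul_one, hU']

theorem posSemidef_sub_smul_one [DecidableEq ι] {T : Matrix ι ι ℂ} (hT : T.IsHermitian) {r : ℝ}
    (hr : ∀ i, r ≤ hT.eigenvalues i) : (T - (r : ℂ) • 1).PosSemidef := by
  obtain ⟨U, h⟩ := hT.exists_diagonal_sub r
  rw [h]
  refine PosSemidef.mul_mul_conjTranspose_same (PosSemidef.diagonal fun i => ?_) U
  have := hr i
  simp only [Pi.zero_apply, Complex.zero_le_real]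
  linarith

theorem posSemidef_neg_sub_smul_one [DecidableEq ι] {T : Matrix ι ι ℂ} (hT : T.IsHermitian) {r : ℝ}
    (hr : ∀ i, hT.eigenvalues i ≤ r) : (-(T - (r : ℂ) • 1)).PosSemidef := by
  obtain ⟨U, h⟩ := hT.exists_diagonal_sub r
  rw [h, ← Matrix.neg_mul, ← Matrix.mul_neg, diagonal_neg]
  refine PosSemidef.mul_mul_conjTranspose_same (PosSemidef.diagonal fun i => ?_) U
  have := hr i
  rw [← Complex.ofReal_neg]
  simp only [Pi.zero_apply, Complex.zero_le_real]
  linarith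

theorem rank_sub_eigenvalue_lt [DecidableEq ι] {T : Matrix ι ι ℂ} (hT : T.IsHermitian) (i : ι) :
    (T - (hT.eigenvalues i : ℂ) • 1).rank < Fintype.card ι := by
  refine lt_of_le_of_ne (rank_le_card_width _) fun h => ?_
  have hv := hT.mulVec_eigenvectorBasis i
  have hne := (hT.eigenvectorBasis.orthonormal).ne_zero i
  have hk := LinearMap.finrank_range_add_finrank_ker (T - (hT.eigenvalues i : ℂ) • 1).mulVecLin
  rw [← Matrix.rank, h, Module.finrank_pi, Nat.add_eq_left, Submodule.finrank_eq_zero] at hk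
  have h0 : (hT.eigenvectorBasis i : ι → ℂ) ∈
      LinearMap.ker (T - (hT.eigenvalues i : ℂ) • 1).mulVecLin := by
    rw [LinearMap.mem_ker, mulVecLin_apply, sub_mulVec, hv, smul_mulVec, one_mulVec]
    simp
  rw [hk, Submodule.mem_bot] at h0
  exact hne (by ext j; exact congrFun h0 j)

/-- If the faces of `ρ` and of its partial transpose share a second operator, then a multiple of `ρ`
is a sum of two PPT states of smaller total rank. -/
theorem exists_decomposition {p q : ℕ} {C : Matrix (Fin p) (Fin n × Fin m) ℂ}
    {C' : Matrix (Fin q) (Fin n × Fin m) ℂ} (hCC : pt (Cᴴ * C) = C'ᴴ * C')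
    {T : Matrix (Fin p) (Fin p) ℂ} {T' : Matrix (Fin q) (Fin q) ℂ}
    (hT : pt (Cᴴ * T * C) = C'ᴴ * T' * C') (hne : ∀ c : ℂ, T ≠ c • 1) :
    ∃ (ρ₁ ρ₂ : Matrix (Fin n × Fin m) (Fin n × Fin m) ℂ) (r : ℝ), 0 < r ∧
      PPT ρ₁ ∧ PPT ρ₂ ∧ ρ₁ + ρ₂ = (r : ℂ) • (Cᴴ * C) ∧
      ρ₁.rank + (pt ρ₁).rank < p + q ∧ ρ₂.rank + (pt ρ₂).rank < p + q := by
  wlog hH : T.IsHermitian ∧ T'.IsHermitian generalizing T T'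
  · have hT2 : pt (Cᴴ * Tᴴ * C) = C'ᴴ * T'ᴴ * C' := by
      have := congrArg conjTranspose hT
      rw [← pt_conjTranspose] at this
      simpa [Matrix.mul_assoc] using this
    have h1 : pt (Cᴴ * (T + Tᴴ) * C) = C'ᴴ * (T' + T'ᴴ) * C' := by
      simp only [Matrix.mul_add, Matrix.add_mul, pt_add, hT, hT2]
    have h2 : pt (Cᴴ * (Complex.I • (T - Tᴴ)) * C) =
        C'ᴴ * (Complex.I • (T' - T'ᴴ)) * C' := by
      simp only [Matrix.mul_sub, Matrix.sub_mul, Matrix.mul_smul, Matrix.smul_mul, pt_smul,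
        pt_sub, hT, hT2]
    have hI {k : ℕ} (A : Matrix (Fin k) (Fin k) ℂ) : (Complex.I • (A - Aᴴ)).IsHermitian := by
      rw [IsHermitian, conjTranspose_smul, conjTranspose_sub, conjTranspose_conjTranspose]
      simp [← smul_neg]
    have hA2 {k : ℕ} (A : Matrix (Fin k) (Fin k) ℂ) : (A + Aᴴ).IsHermitian := by
      rw [IsHermitian, conjTranspose_add, conjTranspose_conjTranspose, add_comm]
    by_cases hs : ∀ c : ℂ, T + Tᴴ ≠ c • 1
    · exact this h1 hs ⟨hA2 T,
        hA2 T'⟩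
    refine this h2 (fun c hc => ?_) ⟨hI T, hI T'⟩
    push Not at hs
    obtain ⟨d, hd⟩ := hs
    refine hne ((d - Complex.I * c) / 2) ?_
    have hc' := congrArg (fun M => Complex.I • M) hc
    simp only [smul_smul, Complex.I_mul_I, neg_smul, one_smul] at hc'
    have : T + T = (d - Complex.I * c) • (1 : Matrix (Fin p) (Fin p) ℂ) := by
      rw [sub_smul, ← hd, ← hc']
      abel
    rw [div_eq_inv_mul, mul_smul, ← this, ← two_smul ℂ T, smul_smul]
    norm_num
  obtain ⟨hH, hH'⟩ := hH
  let ev : Fin p ⊕ Fin q → ℝ := Sum.elim hH.eigenvalues hH'.eigenvalues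
  have hp : Nonempty (Fin p ⊕ Fin q) := by
    rcases Nat.eq_zero_or_pos p with rfl | hp
    · exact absurd (Subsingleton.elim _ _) (hne 0)
    · exact ⟨Sum.inl ⟨0, hp⟩⟩
  -- the pencil `T - r` is degenerate at every eigenvalue
  have hrank (x : Fin p ⊕ Fin q) (A : Matrix (Fin p) (Fin p) ℂ) (A' : Matrix (Fin q) (Fin q) ℂ)
      (hA : A = T - (ev x : ℂ) • 1 ∨ A = -(T - (ev x : ℂ) • 1))
      (hA' : A' = T' - (ev x : ℂ) • 1 ∨ A' = -(T' - (ev x : ℂ) • 1)) :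
      (Cᴴ * A * C).rank + (C'ᴴ * A' * C').rank < p + q := by
    have hr : (Cᴴ * A * C).rank ≤ A.rank := (rank_mul_le_left _ _).trans (rank_mul_le_right _ _)
    have hr' : (C'ᴴ * A' * C').rank ≤ A'.rank :=
      (rank_mul_le_left _ _).trans (rank_mul_le_right _ _)
    have hn {k : ℕ} (M : Matrix (Fin k) (Fin k) ℂ) : (-M).rank = M.rank := by
      rw [← neg_one_smul ℂ M]
      exact rank_smul_of_mem_nonZeroDivisors M (by simp)
    have e1 : A.rank = (T - (ev x : ℂ) • 1).rank := by rcases hA with rfl | rfl <;> simp only [hn]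
    have e2 : A'.rank = (T' - (ev x : ℂ) • 1).rank := by rcases hA' with rfl | rfl <;> simp only [hn]
    have h1 := rank_le_card_width (T - (ev x : ℂ) • 1)
    have h2 := rank_le_card_width (T' - (ev x : ℂ) • 1)
    rw [Fintype.card_fin] at h1 h2
    rcases x with i | i
    · have := rank_sub_eigenvalue_lt hH i
      rw [Fintype.card_fin] at this
      simp only [ev, Sum.elim_inl] at *
      omega
    · have := rank_sub_eigenvalue_lt hH' i
      rw [Fintype.card_fin] at this
      simp only [ev, Sum.elim_inr] at *
      omega
  obtain ⟨a, ha⟩ := Finite.exists_min ev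
  obtain ⟨b, hb⟩ := Finite.exists_max ev
  have p1 := posSemidef_sub_smul_one hH fun i => ha (Sum.inl i)
  have p1' := posSemidef_sub_smul_one hH' fun i => ha (Sum.inr i)
  have p2 := posSemidef_neg_sub_smul_one hH fun i => hb (Sum.inl i)
  have p2' := posSemidef_neg_sub_smul_one hH' fun i => hb (Sum.inr i)
  have hpt (r : ℂ) : pt (Cᴴ * (T - r • 1) * C) = C'ᴴ * (T' - r • 1) * C' := by
    simp only [Matrix.mul_sub, Matrix.sub_mul, pt_sub, hT, Matrix.mul_smul, Matrix.smul_mul, pt_smul,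
      Matrix.mul_one, hCC]
  have hpt' (r : ℂ) : pt (Cᴴ * (-(T - r • 1)) * C) = C'ᴴ * (-(T' - r • 1)) * C' := by
    have := hpt r
    simp only [Matrix.mul_neg, Matrix.neg_mul, ← this]
    rfl
  refine ⟨Cᴴ * (T - (ev a : ℂ) • 1) * C, Cᴴ * (-(T - (ev b : ℂ) • 1)) * C, ev b - ev a, ?_,
    ⟨p1.conjTranspose_mul_mul_same C, ?_⟩, ⟨p2.conjTranspose_mul_mul_same C, ?_⟩, ?_, ?_, ?_⟩
  · refine sub_pos.2 (lt_of_le_of_ne (ha b) fun h => hne (ev a) ?_)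
    obtain ⟨U, hU⟩ := hH.exists_diagonal_sub (ev a)
    have h0 (i) : hH.eigenvalues i - ev a = 0 :=
      sub_eq_zero.2 (le_antisymm (h ▸ hb (Sum.inl i)) (ha (Sum.inl i)))
    simp only [h0, Complex.ofReal_zero, diagonal_zero, Matrix.mul_zero, Matrix.zero_mul] at hU
    exact sub_eq_zero.1 hU
  · rw [hpt]; exact p1'.conjTranspose_mul_mul_same C'
  · rw [hpt']; exact p2'.conjTranspose_mul_mul_same C'
  · rw [← Matrix.add_mul, ← Matrix.mul_add]
    have : T - (ev a : ℂ) • 1 + -(T - (ev b : ℂ) • 1) = ((ev b - ev a : ℝ) : ℂ) • 1 := by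
      rw [Complex.ofReal_sub, sub_smul]; abel
    rw [this, Matrix.mul_smul, Matrix.smul_mul, Matrix.mul_one]
  · rw [hpt]; exact hrank a _ _ (Or.inl rfl) (Or.inl rfl)
  · rw [hpt']; exact hrank b _ _ (Or.inr rfl) (Or.inr rfl)

theorem exists_second_operator {p q : ℕ} {C : Matrix (Fin p) (Fin n × Fin m) ℂ}
    {C' : Matrix (Fin q) (Fin n × Fin m) ℂ} (hCC : pt (Cᴴ * C) = C'ᴴ * C')
    {R' : Matrix (Fin n × Fin m) (Fin q) ℂ} (hR' : C' * R' = 1)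
    (hpq : (n * m) ^ 2 + 2 ≤ p ^ 2 + q ^ 2) :
    ∃ (T : Matrix (Fin p) (Fin p) ℂ) (T' : Matrix (Fin q) (Fin q) ℂ),
      pt (Cᴴ * T * C) = C'ᴴ * T' * C' ∧ ∀ c : ℂ, T ≠ c • 1 := by
  let Φ : (Matrix (Fin p) (Fin p) ℂ × Matrix (Fin q) (Fin q) ℂ) →ₗ[ℂ]
      Matrix (Fin n × Fin m) (Fin n × Fin m) ℂ :=
    { toFun := fun S => pt (Cᴴ * S.1 * C) - C'ᴴ * S.2 * C'
      map_add' := fun S S' => by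
        simp only [Prod.fst_add, Prod.snd_add, Matrix.mul_add, Matrix.add_mul, pt_add]
        abel
      map_smul' := fun c S => by
        simp only [Prod.smul_fst, Prod.smul_snd, Matrix.mul_smul, Matrix.smul_mul, pt_smul,
          smul_sub, RingHom.id_apply] }
  have hdim := LinearMap.finrank_range_add_finrank_ker Φ
  have hrange := Submodule.finrank_le (LinearMap.range Φ)
  simp only [Module.finrank_prod, Module.finrank_matrix, Fintype.card_fin, Fintype.card_prod,
    Module.finrank_self, mul_one] at hdim hrange
  have hnot : ¬ LinearMap.ker Φ ≤ Submodule.span ℂ {(1, 1)} := fun hle => by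
    have h1 := (Submodule.finrank_mono hle).trans (finrank_span_le_card _)
    simp only [Set.toFinset_singleton, Finset.card_singleton] at h1
    nlinarith
  obtain ⟨⟨T, T'⟩, hT, hTs⟩ := SetLike.not_le_iff_exists.1 hnot
  have hT0 : pt (Cᴴ * T * C) = C'ᴴ * T' * C' := sub_eq_zero.1 hT
  refine ⟨T, T', hT0, fun c hc => hTs ?_⟩
  have h1 : C'ᴴ * T' * C' = C'ᴴ * (c • (1 : Matrix (Fin q) (Fin q) ℂ)) * C' := by
    rw [← hT0, hc]
    simp only [Matrix.mul_smul, Matrix.smul_mul, pt_smul, Matrix.mul_one, hCC]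
  have h2 : T' = c • 1 := by
    have hL : R'ᴴ * C'ᴴ = 1 := by rw [← conjTranspose_mul, hR', conjTranspose_one]
    have := congrArg (fun M => R'ᴴ * M * R') h1
    simpa only [Matrix.mul_assoc, hR', Matrix.mul_one, ← Matrix.mul_assoc R'ᴴ, hL,
      Matrix.one_mul] using this
  rw [Submodule.mem_span_singleton]
  exact ⟨c, by rw [hc, h2]; rfl⟩

/-- A state of rank at most `n` on `ℂ^n ⊗ ℂ^2` has a product vector in its kernel. -/
theorem exists_kernel_prodVec_two {p : ℕ} (hn : 0 < n) (hp : p ≤ n)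
    (C : Matrix (Fin p) (Fin n × Fin 2) ℂ) :
    ∃ φ : Fin n → ℂ, φ ≠ 0 ∧ ∃ ψ : Fin 2 → ℂ, ψ ≠ 0 ∧ C *ᵥ prodVec φ ψ = 0 := by
  let e : Fin 2 → Fin 2 → ℂ := fun i => Pi.single i 1
  by_cases hker : LinearMap.ker (lSlice C (e 0)).mulVecLin = ⊥
  · let D := LinearEquiv.ofBijective (lSlice C (e 0)).mulVecLin
      ⟨LinearMap.ker_eq_bot.1 hker, by
        rw [← LinearMap.range_eq_top]
        refine Submodule.eq_top_of_finrank_eq (le_antisymm (Submodule.finrank_le _) ?_)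
        have := LinearMap.finrank_range_add_finrank_ker (lSlice C (e 0)).mulVecLin
        rw [hker] at this
        simp at this ⊢
        omega⟩
    have : Nonempty (Fin n) := ⟨⟨0, hn⟩⟩
    obtain ⟨r, hr⟩ := Module.End.exists_eigenvalue
      (D.symm.toLinearMap ∘ₗ (lSlice C (e 1)).mulVecLin)
    obtain ⟨v, hv⟩ := hr.exists_hasEigenvector
    refine ⟨v, hv.2, e 1 + (-r) • e 0, fun h => by simpa [e] using congrFun h 1, ?_⟩
    have h1 := congrArg D hv.apply_eq_smul
    rw [LinearMap.comp_apply, LinearEquiv.coe_coe, LinearEquiv.apply_symm_apply, map_smul] at h1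
    have h2 : C *ᵥ prodVec v (e 1) = r • (C *ᵥ prodVec v (e 0)) := by
      rw [← lSlice_mulVec, ← lSlice_mulVec]
      exact h1
    rw [prodVec_add_right, prodVec_smul_right, mulVec_add, mulVec_smul, h2, neg_smul,
      add_neg_cancel]
  · obtain ⟨v, hv, hv0⟩ := Submodule.exists_mem_ne_zero_of_ne_bot hker
    refine ⟨v, hv0, e 0, fun h => by simpa [e] using congrFun h 0, ?_⟩
    rw [← lSlice_mulVec]
    exact hv

/-- A PPT state on `ℂ^{n+1} ⊗ ℂ^2` with a product vector in its kernel splits. -/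
theorem separable_of_kernel_two [DecidableEq ι] (hN : AllSep n 2)
    {C : Matrix ι (Fin (n + 1) × Fin 2) ℂ} (hC : PPT (Cᴴ * C)) {φ : Fin (n + 1) → ℂ} (hφ : φ ≠ 0)
    {ψ : Fin 2 → ℂ} (hψ : ψ ≠ 0) (h : C *ᵥ prodVec φ ψ = 0) : Separable (Cᴴ * C) := by
  refine separable_of_rank_le_one hN hC hφ ?_
  let ψ' : Fin 2 → ℂ := star ![-ψ 1, ψ 0]
  refine ⟨C *ᵥ prodVec φ ψ', fun y => ?_⟩
  let s : ℂ := star ψ ⬝ᵥ ψ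
  have hs : s ≠ 0 := fun h => hψ (dotProduct_star_self_eq_zero.1 h)
  have hs' : s = conj (ψ 0) * ψ 0 + conj (ψ 1) * ψ 1 := by simp [s]
  have hy : y = ((star ψ ⬝ᵥ y) / s) • ψ + ((star ψ' ⬝ᵥ y) / s) • ψ' := by
    funext i
    simp only [Pi.add_apply, Pi.smul_apply, smul_eq_mul]
    field_simp
    rw [hs']
    fin_cases i <;> simp [ψ', dotProduct] <;> ring
  refine ⟨(star ψ' ⬝ᵥ y) / s, ?_⟩
  conv_lhs => rw [hy]
  rw [prodVec_add_right, prodVec_smul_right, prodVec_smul_right, mulVec_add, mulVec_smul,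
    mulVec_smul, h, smul_zero, zero_add]

theorem conjTranspose_mul_self_eq_sum {α : Type*} (C : Matrix ι α ℂ) :
    Cᴴ * C = ∑ k, vecMulVec (star (C k)) (C k) := by
  ext a b
  simp [mul_apply, Matrix.sum_apply, vecMulVec_apply]

theorem allSep_one (m : ℕ) : AllSep 1 m := fun ρ hρ => by
  obtain ⟨C, -, h, -⟩ := hρ.1.exists_factorization
  rw [h, conjTranspose_mul_self_eq_sum]
  refine Separable.sum _ fun k _ => ?_
  convert separable_prodProj 1 (star fun j => C k (0, j)) using 1
  ext ⟨a, b⟩ ⟨c, d⟩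
  simp [prodProj_apply, vecMulVec_apply, Subsingleton.elim a 0, Subsingleton.elim c 0]

/-- The inductive step of Woronowicz's theorem: it suffices to treat the states that cannot be
decomposed for dimension reasons. -/
theorem allSep_succ_two (hN : AllSep n 2)
    (hbase : ∀ ρ : Matrix (Fin (n + 1) × Fin 2) (Fin (n + 1) × Fin 2) ℂ, PPT ρ → n + 1 < ρ.rank →
      n + 1 < (pt ρ).rank → ρ.rank ^ 2 + (pt ρ).rank ^ 2 < ((n + 1) * 2) ^ 2 + 2 → Separable ρ) :
    AllSep (n + 1) 2 := by
  have hlow : ∀ ρ : Matrix (Fin (n + 1) × Fin 2) (Fin (n + 1) × Fin 2) ℂ, PPT ρ →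
      ρ.rank ≤ n + 1 → Separable ρ := fun ρ hρ hr => by
    obtain ⟨C, -, h, -⟩ := hρ.1.exists_factorization
    obtain ⟨φ, hφ, ψ, hψ, h0⟩ := exists_kernel_prodVec_two n.succ_pos hr C
    rw [h] at hρ ⊢
    exact separable_of_kernel_two hN hρ hφ hψ h0
  suffices ∀ (k : ℕ) (ρ : Matrix (Fin (n + 1) × Fin 2) (Fin (n + 1) × Fin 2) ℂ), PPT ρ →
      ρ.rank + (pt ρ).rank = k → Separable ρ from fun ρ hρ => this _ ρ hρ rfl
  intro k
  induction k using Nat.strong_induction_on with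
  | _ k ih =>
    intro ρ hρ hk
    rcases Nat.lt_or_ge (n + 1) ρ.rank with h1 | h1
    · rcases Nat.lt_or_ge (n + 1) (pt ρ).rank with h2 | h2
      · rcases Nat.lt_or_ge (ρ.rank ^ 2 + (pt ρ).rank ^ 2) (((n + 1) * 2) ^ 2 + 2) with h3 | h3
        · exact hbase ρ hρ h1 h2 h3
        · obtain ⟨C, R, hC, -⟩ := hρ.1.exists_factorization
          obtain ⟨C', R', hC', hR'⟩ := hρ.2.exists_factorization
          have hCC : pt (Cᴴ * C) = C'ᴴ * C' := by rw [← hC, ← hC']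
          obtain ⟨T, T', hT, hne⟩ := exists_second_operator hCC hR' h3
          obtain ⟨ρ₁, ρ₂, r, hr, p1, p2, hsum, l1, l2⟩ := exists_decomposition hCC hT hne
          rw [← hC] at hsum
          have hs := ((ih _ (hk ▸ l1) ρ₁ p1 rfl).add (ih _ (hk ▸ l2) ρ₂ p2 rfl)).smul
            (inv_nonneg.2 hr.le)
          rwa [hsum, smul_smul, ← Complex.ofReal_mul, inv_mul_cancel₀ hr.ne', Complex.ofReal_one,
            one_smul] at hs
      · exact (hlow _ hρ.pt h2).pt
    · exact hlow ρ hρ h1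

theorem allSep_two_two : AllSep 2 2 :=
  allSep_succ_two (allSep_one 2) fun ρ _ h1 h2 h3 => by nlinarith

/-- The spectral theorem for normal matrices. -/
theorem exists_orthonormal_eigenvectors [DecidableEq κ] {N : Matrix κ κ ℂ} (hN : Nᴴ * N = N * Nᴴ) :
    ∃ (k : ℕ) (U : Fin k → κ → ℂ) (z : Fin k → ℂ), ∑ t, vecMulVec (U t) (star (U t)) = 1 ∧
      ∀ t, N *ᵥ U t = z t • U t ∧ Nᴴ *ᵥ U t = star (z t) • U t := by
  set A : Matrix κ κ ℂ := N + Nᴴ with hA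
  set B : Matrix κ κ ℂ := Complex.I • (N - Nᴴ) with hB
  have hAh : A.IsHermitian := by simp [IsHermitian, hA, add_comm]
  have hBh : B.IsHermitian := by
    simp [IsHermitian, hB, ← smul_neg]
  have hAs := isSymmetric_toEuclideanLin_iff.2 hAh
  have hBs := isSymmetric_toEuclideanLin_iff.2 hBh
  have hAB : Commute A.toEuclideanLin B.toEuclideanLin := by
    have : A * B = B * A := by
      simp only [hA, hB, Matrix.mul_smul, Matrix.smul_mul, Matrix.add_mul, Matrix.mul_add,
        Matrix.mul_sub, Matrix.sub_mul, hN, ← smul_add]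
      congr 1
      abel
    ext v : 2
    have := congrFun (congrArg (fun M => M *ᵥ v.ofLp) this)
    simpa [toEuclideanLin, mulVec_mulVec] using this _
  have hV := LinearMap.IsSymmetric.directSum_isInternal_of_commute hAs hBs hAB
  have hO := LinearMap.IsSymmetric.orthogonalFamily_eigenspace_inf_eigenspace hAs hBs
  have hfin := WellFoundedGT.finite_ne_bot_of_iSupIndep hV.submodule_iSupIndep
  have hV' := DirectSum.isInternal_ne_bot_iff.2 hV
  have hO' := hO.comp (Subtype.val_injective (p := fun i : ℂ × ℂ =>
    (Module.End.eigenspace A.toEuclideanLin i.2 ⊓ Module.End.eigenspace B.toEuclideanLin i.1) ≠ ⊥))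
  have : Fintype {i : ℂ × ℂ // (Module.End.eigenspace A.toEuclideanLin i.2 ⊓
    Module.End.eigenspace B.toEuclideanLin i.1) ≠ ⊥} := hfin.fintype
  let b := hV'.subordinateOrthonormalBasis rfl hO'
  have hb := fun t => hV'.subordinateOrthonormalBasis_subordinate rfl t hO'
  have hone : ∀ t, star (b t).ofLp ⬝ᵥ (b t).ofLp = 1 := fun t => by
    have := inner_self_eq_one_of_norm_eq_one (𝕜 := ℂ) (b.orthonormal.1 t)
    rwa [EuclideanSpace.inner_eq_star_dotProduct, dotProduct_comm] at this
  have hev : ∀ t, ∃ c d : ℂ, A *ᵥ (b t).ofLp = c • (b t).ofLp ∧ B *ᵥ (b t).ofLp = d • (b t).ofLp :=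
    fun t => ⟨_, _, congrArg WithLp.ofLp (Module.End.mem_eigenspace_iff.1 (hb t).1),
      congrArg WithLp.ofLp (Module.End.mem_eigenspace_iff.1 (hb t).2)⟩
  choose c d hc hd using hev
  have hNA : N = (1 / 2 : ℂ) • A + (-Complex.I / 2) • B := by
    ext i j
    simp only [hA, hB, Matrix.add_apply, Matrix.smul_apply, Matrix.sub_apply, smul_eq_mul]
    linear_combination ((N i j - Nᴴ i j) / 2) * Complex.I_sq
  have hNB : Nᴴ = (1 / 2 : ℂ) • A + (Complex.I / 2) • B := by
    ext i j
    simp only [hA, hB, Matrix.add_apply, Matrix.smul_apply, Matrix.sub_apply, smul_eq_mul]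
    linear_combination (-(N i j - Nᴴ i j) / 2) * Complex.I_sq
  have h1 : ∀ t, N *ᵥ (b t).ofLp = (1 / 2 * c t - Complex.I / 2 * d t) • (b t).ofLp := fun t => by
    rw [hNA, add_mulVec, smul_mulVec, smul_mulVec, hc, hd]
    module
  have h2 : ∀ t, Nᴴ *ᵥ (b t).ofLp = (1 / 2 * c t + Complex.I / 2 * d t) • (b t).ofLp := fun t => by
    rw [hNB, add_mulVec, smul_mulVec, smul_mulVec, hc, hd]
    module
  refine ⟨_, fun t => (b t).ofLp, fun t => 1 / 2 * c t - Complex.I / 2 * d t, ?_,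
    fun t => ⟨h1 t, ?_⟩⟩
  · ext i j
    have := congrArg (fun v => v.ofLp i) (b.sum_repr' (WithLp.toLp 2 (Pi.single j 1)))
    simp only [EuclideanSpace.inner_eq_star_dotProduct, single_dotProduct, one_mul,
      WithLp.ofLp_sum, WithLp.ofLp_smul, Finset.sum_apply, Pi.smul_apply, smul_eq_mul,
      Pi.star_apply] at this
    simp only [Matrix.sum_apply, vecMulVec_apply, Pi.star_apply]
    rw [one_apply, ← Pi.single_apply j (1 : ℂ) i, ← this]
    exact Finset.sum_congr rfl fun t _ => mul_comm _ _
  · have : 1 / 2 * c t + Complex.I / 2 * d t = star (1 / 2 * c t - Complex.I / 2 * d t) := by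
      have h3 : star (b t).ofLp ⬝ᵥ (Nᴴ *ᵥ (b t).ofLp) = star (N *ᵥ (b t).ofLp) ⬝ᵥ (b t).ofLp := by
        rw [star_mulVec, dotProduct_mulVec]
      rwa [h1, h2, star_smul, dotProduct_smul, smul_dotProduct, hone, smul_eq_mul, smul_eq_mul,
        mul_one, mul_one] at h3
    rw [← this, h2]

/-- A state with a normal dilation is separable. -/
theorem separable_of_normal [DecidableEq κ] {N : Matrix κ κ ℂ} (hN : Nᴴ * N = N * Nᴴ)
    (e : Fin n → κ) {ρ : Matrix (Fin n × Fin m) (Fin n × Fin m) ℂ}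
    (h : ∀ k i l j, ρ (k, i) (l, j) = ((N ^ (i : ℕ))ᴴ * N ^ (j : ℕ)) (e k) (e l)) :
    Separable ρ := by
  obtain ⟨q, U, z, hU, hz⟩ := exists_orthonormal_eigenvectors hN
  have hpow : ∀ {M : Matrix κ κ ℂ} {u : κ → ℂ} {c : ℂ}, M *ᵥ u = c • u →
      ∀ i : ℕ, M ^ i *ᵥ u = c ^ i • u := fun {M u c} hM i => by
    induction i with
    | zero => simp
    | succ i ih => rw [pow_succ, ← mulVec_mulVec, hM, mulVec_smul, ih, smul_smul, pow_succ']
  refine (?_ : ρ = ∑ t, prodProj (U t ∘ e) fun i => star (z t) ^ (i : ℕ)) ▸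
    separable_sum _ _ _
  ext ⟨k, i⟩ ⟨l, j⟩
  rw [h, ← Matrix.mul_one ((N ^ (i : ℕ))ᴴ * N ^ (j : ℕ)), ← hU, Matrix.mul_sum]
  simp only [Matrix.sum_apply, mul_vecMulVec, ← mulVec_mulVec, hpow (hz _).1, mulVec_smul,
    conjTranspose_pow, hpow (hz _).2, vecMulVec_apply, prodProj_apply, Pi.smul_apply, smul_eq_mul,
    Pi.star_apply, Function.comp_apply]
  exact Finset.sum_congr rfl fun t _ => by
    simp only [← starRingEnd_apply, map_pow, Complex.conj_conj]
    ring

theorem conj_dotProduct_star (x y : ι → ℂ) : conj (star x ⬝ᵥ y) = star y ⬝ᵥ x := by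
  rw [starRingEnd_apply, ← star_dotProduct_star, star_star]

/-- Four vectors of `ℂ^3` with matching Gram matrices are related by a unimodular multiplier. -/
theorem exists_unimodular_relation {a b f g : Fin 3 → ℂ} (hr : star a ⬝ᵥ a = star b ⬝ᵥ b)
    (hs : star f ⬝ᵥ f = star g ⬝ᵥ g) (hbf : star b ⬝ᵥ f = 0) (hag : star a ⬝ᵥ g = 0)
    (hx : star b ⬝ᵥ g = conj (star a ⬝ᵥ f))
    (hR : (star a ⬝ᵥ a) ^ 2 ≠ (star a ⬝ᵥ b) * (star b ⬝ᵥ a)) :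
    ∃ ω d : ℂ, conj ω * ω = 1 ∧ f - d • b = ω • (g - conj d • a) := by
  obtain ⟨c, hc, i, hi⟩ := Fintype.not_linearIndependent_iff.1
    (fun h : LinearIndependent ℂ ![f, b, g, a] => by simpa using h.fintype_card_le_finrank)
  obtain ⟨r, hrdef⟩ : ∃ r, star a ⬝ᵥ a = r := ⟨_, rfl⟩
  obtain ⟨s, hsdef⟩ : ∃ s, star f ⬝ᵥ f = s := ⟨_, rfl⟩
  obtain ⟨x, hxdef⟩ : ∃ x, star a ⬝ᵥ f = x := ⟨_, rfl⟩
  obtain ⟨y, hydef⟩ : ∃ y, star a ⬝ᵥ b = y := ⟨_, rfl⟩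
  have hr' : conj r = r := by rw [← hrdef, conj_dotProduct_star]
  have hy' : star b ⬝ᵥ a = conj y := by rw [← hydef, conj_dotProduct_star]
  have hx' : star f ⬝ᵥ a = conj x := by rw [← hxdef, conj_dotProduct_star]
  have hfb : star f ⬝ᵥ b = 0 := by rw [← conj_dotProduct_star, hbf, map_zero]
  have hga : star g ⬝ᵥ a = 0 := by rw [← conj_dotProduct_star, hag, map_zero]
  have hgb : star g ⬝ᵥ b = x := by rw [← conj_dotProduct_star, hx, Complex.conj_conj, hxdef]
  rw [hxdef] at hx
  rw [hrdef] at hr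
  rw [hsdef] at hs
  rw [hrdef, hydef, hy'] at hR
  obtain ⟨R, hRdef⟩ : ∃ R, R = r ^ 2 - y * conj y := ⟨_, rfl⟩
  have hR0 : R ≠ 0 := hRdef ▸ sub_ne_zero.2 hR
  have hR' : conj R = R := by simp [hRdef, hr', mul_comm]
  by_cases hdeg : s * R = r * (x * conj x)
  · have h1 : R • f = x • (r • a - conj y • b) := by
      rw [← sub_eq_zero, ← dotProduct_star_self_eq_zero]
      simp only [star_sub, star_smul, sub_dotProduct, dotProduct_sub, smul_dotProduct,
        dotProduct_smul, smul_eq_mul, hsdef, hxdef, hydef, hrdef, hx', hy', hfb, hbf, ← hr]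
      simp only [← starRingEnd_apply, hR', hr', Complex.conj_conj]
      rw [hRdef] at hdeg ⊢
      linear_combination (r ^ 2 - y * conj y) * hdeg
    have h2 : R • g = conj x • (r • b - y • a) := by
      rw [← sub_eq_zero, ← dotProduct_star_self_eq_zero]
      simp only [star_sub, star_smul, sub_dotProduct, dotProduct_sub, smul_dotProduct,
        dotProduct_smul, smul_eq_mul, ← hs, hgb, hydef, hrdef, hx, hy', hag, hga, ← hr]
      simp only [← starRingEnd_apply, hR', hr', Complex.conj_conj]
      rw [hRdef] at hdeg ⊢
      linear_combination (r ^ 2 - y * conj y) * hdeg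
    obtain ⟨d, hd⟩ : ∃ d, R * d = -(x * conj y + conj x * r) := ⟨_, mul_div_cancel₀ _ hR0⟩
    have hd' := congrArg conj hd
    simp only [map_neg, map_add, map_mul, Complex.conj_conj, hR', hr'] at hd'
    refine ⟨1, d, by simp, smul_right_injective _ hR0 ?_⟩
    linear_combination (norm := module) h1 - h2 - hd • b + hd' • a
  · have hc' : c 0 • f + c 1 • b + c 2 • g + c 3 • a = 0 := by
      simpa [Fin.sum_univ_four] using hc
    have ea := congrArg (star a ⬝ᵥ ·) hc'
    have eb := congrArg (star b ⬝ᵥ ·) hc'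
    simp only [dotProduct_add, dotProduct_smul, dotProduct_zero, smul_eq_mul, hxdef, hydef, hag,
      hrdef, hbf, ← hr, hx, hy'] at ea eb
    have e1 : c 1 * R = c 0 * x * conj y - c 2 * conj x * r := by
      rw [hRdef]
      linear_combination r * eb - conj y * ea
    have e3 : c 3 * R = c 2 * conj x * y - c 0 * x * r := by
      rw [hRdef]
      linear_combination r * ea - y * eb
    have e1' := congrArg conj e1
    have e3' := congrArg conj e3
    simp only [map_sub, map_mul, Complex.conj_conj, hR', hr'] at e1' e3'
    have h4 : c 0 • f + c 1 • b = -(c 2 • g + c 3 • a) :=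
      eq_neg_of_add_eq_zero_left (by rw [← hc']; module)
    have h5 : star (c 0 • f + c 1 • b) ⬝ᵥ (c 0 • f + c 1 • b) =
        star (c 2 • g + c 3 • a) ⬝ᵥ (c 2 • g + c 3 • a) := by
      rw [h4, star_neg, neg_dotProduct_neg]
    simp only [star_add, star_smul, add_dotProduct, dotProduct_add, smul_dotProduct,
      dotProduct_smul, smul_eq_mul, hsdef, hrdef, ← hr, ← hs, hbf, hfb, hag, hga] at h5
    simp only [← starRingEnd_apply] at h5
    have h6 : (c 0 * conj (c 0) - c 2 * conj (c 2)) * (s * R - r * (x * conj x)) = 0 := by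
      refine (mul_eq_zero.1 (?_ : R * _ = 0)).resolve_left hR0
      linear_combination R ^ 2 * h5 - r * (conj (c 1) * R * e1 +
        (c 0 * x * conj y - c 2 * conj x * r) * e1' - conj (c 3) * R * e3 -
        (c 2 * conj x * y - c 0 * x * r) * e3') -
        r * (c 0 * conj (c 0) - c 2 * conj (c 2)) * x * conj x * hRdef
    have h7 := sub_eq_zero.1 ((mul_eq_zero.1 h6).resolve_right (sub_ne_zero.2 hdeg))
    have h0 : c 0 ≠ 0 := fun h => by
      have h2 : c 2 = 0 := by simpa [h] using h7
      have h1 : c 1 = 0 := by simpa [h, h2, hR0] using e1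
      have h3 : c 3 = 0 := by simpa [h, h2, hR0] using e3
      fin_cases i <;> simp_all
    have h0' : conj (c 0) ≠ 0 := (map_ne_zero _).2 h0
    refine ⟨-c 2 / c 0, -c 1 / c 0, ?_, smul_right_injective _ h0 ?_⟩
    · simp only [map_div₀, map_neg]
      field_simp
      linear_combination -h7
    · have h8 : c 3 * conj (c 0) = c 2 * conj (c 1) := by
        refine mul_right_cancel₀ hR0 ?_
        linear_combination conj (c 0) * e3 - c 2 * e1' - x * r * h7
      have h9 : conj (-c 1 / c 0) * c 2 = -c 3 := by
        simp only [map_div₀, map_neg]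
        field_simp
        linear_combination h8
      have h10 : c 0 * (-c 1 / c 0) = -c 1 := mul_div_cancel₀ _ h0
      have h11 : c 0 * (-c 2 / c 0) = -c 2 := mul_div_cancel₀ _ h0
      linear_combination (norm := module) hc' - h10 • b - h11 • (g - conj (-c 1 / c 0) • a) - h9 • a

theorem dotProduct_vecMulVec_mulVec (u v x y : ι → ℂ) :
    x ⬝ᵥ (vecMulVec u v *ᵥ y) = (x ⬝ᵥ u) * (v ⬝ᵥ y) := by
  rw [vecMulVec_mulVec, dotProduct_smul, op_smul_eq_smul, smul_eq_mul, mul_comm]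

section Dilation

variable {B : Matrix (Fin 3) (Fin 3) ℂ} {a b : Fin 3 → ℂ}

theorem exists_dilation (H : Bᴴ * B + vecMulVec b (star b) = B * Bᴴ + vecMulVec a (star a)) :
    vecMulVec a (star a) = vecMulVec b (star b) ∨
      ∃ ω d : ℂ, conj ω * ω = 1 ∧ B *ᵥ b - d • b = ω • (Bᴴ *ᵥ a - conj d • a) := by
  have hE : Bᴴ * B - B * Bᴴ = vecMulVec a (star a) - vecMulVec b (star b) :=
    sub_eq_sub_iff_add_eq_add.2 (by rw [H, add_comm])
  have hr : star a ⬝ᵥ a = star b ⬝ᵥ b := by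
    have h := congrArg Matrix.trace hE
    rw [trace_sub, trace_sub, Matrix.trace_mul_comm B, sub_self, trace_vecMulVec, trace_vecMulVec,
      dotProduct_comm a, dotProduct_comm b] at h
    exact (sub_eq_zero.1 h.symm)
  have hmul : ∀ M : Matrix (Fin 3) (Fin 3) ℂ, (M * (Bᴴ * B - B * Bᴴ)).trace =
      star a ⬝ᵥ (M *ᵥ a) - star b ⬝ᵥ (M *ᵥ b) := fun M => by
    rw [hE, Matrix.mul_sub, trace_sub, mul_vecMulVec, mul_vecMulVec, trace_vecMulVec,
      trace_vecMulVec, dotProduct_comm, dotProduct_comm (M *ᵥ b)]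
  have hvec : ∀ x : Fin 3 → ℂ, star (B *ᵥ x) ⬝ᵥ (B *ᵥ x) - star (Bᴴ *ᵥ x) ⬝ᵥ (Bᴴ *ᵥ x) =
      (star x ⬝ᵥ a) * (star a ⬝ᵥ x) - (star x ⬝ᵥ b) * (star b ⬝ᵥ x) := fun x => by
    have h := congrArg (fun M => star x ⬝ᵥ (M *ᵥ x)) hE
    simp only [sub_mulVec, dotProduct_sub, dotProduct_vecMulVec_mulVec] at h
    rw [← h, ← mulVec_mulVec, ← mulVec_mulVec, star_mulVec, star_mulVec, dotProduct_mulVec,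
      dotProduct_mulVec, conjTranspose_conjTranspose, ← dotProduct_mulVec, ← dotProduct_mulVec,
      ← dotProduct_mulVec, ← dotProduct_mulVec]
  have ht : star a ⬝ᵥ (B *ᵥ a) = star b ⬝ᵥ (B *ᵥ b) := by
    rw [← sub_eq_zero, ← hmul, Matrix.mul_sub, trace_sub, sub_eq_zero, Matrix.trace_mul_comm,
      Matrix.mul_assoc, Matrix.trace_mul_comm, Matrix.mul_assoc, Matrix.trace_mul_comm B (B * Bᴴ),
      Matrix.mul_assoc]
  have hs : star (B *ᵥ b) ⬝ᵥ (B *ᵥ b) = star (Bᴴ *ᵥ a) ⬝ᵥ (Bᴴ *ᵥ a) := by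
    have h1 := hmul (Bᴴ * B + B * Bᴴ)
    have h0 : ((Bᴴ * B + B * Bᴴ) * (Bᴴ * B - B * Bᴴ)).trace = 0 := by
      rw [Matrix.mul_sub, Matrix.add_mul, Matrix.add_mul, trace_sub, trace_add, trace_add]
      rw [Matrix.trace_mul_comm (Bᴴ * B) (B * Bᴴ), Matrix.mul_assoc B Bᴴ (B * Bᴴ),
        Matrix.trace_mul_comm B]
      simp only [Matrix.mul_assoc]
      ring
    have h2 : ∀ x, star x ⬝ᵥ ((Bᴴ * B + B * Bᴴ) *ᵥ x) =
      star (B *ᵥ x) ⬝ᵥ (B *ᵥ x) + star (Bᴴ *ᵥ x) ⬝ᵥ (Bᴴ *ᵥ x) := fun x => by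
      rw [add_mulVec, dotProduct_add, ← mulVec_mulVec, ← mulVec_mulVec, star_mulVec, star_mulVec,
        dotProduct_mulVec, dotProduct_mulVec, conjTranspose_conjTranspose, ← dotProduct_mulVec,
        ← dotProduct_mulVec, ← dotProduct_mulVec]
    rw [h0, h2, h2] at h1
    have h3 := hvec a
    have h4 := hvec b
    rw [← hr] at h4
    linear_combination (h3 + h1 + h4) / 2
  by_cases hR : (star a ⬝ᵥ a) ^ 2 = (star a ⬝ᵥ b) * (star b ⬝ᵥ a)
  · left
    by_cases hr0 : star a ⬝ᵥ a = 0
    · rw [dotProduct_star_self_eq_zero.1 hr0, dotProduct_star_self_eq_zero.1 (hr.symm.trans hr0)]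
    · have hc : ∀ x y : Fin 3 → ℂ, star (star x ⬝ᵥ y) = star y ⬝ᵥ x := conj_dotProduct_star
      have hab : (star a ⬝ᵥ a) • b = (star a ⬝ᵥ b) • a := by
        rw [← sub_eq_zero, ← dotProduct_star_self_eq_zero]
        simp only [star_sub, star_smul, sub_dotProduct, dotProduct_sub, smul_dotProduct,
          dotProduct_smul, smul_eq_mul, ← hr, hc]
        linear_combination (star a ⬝ᵥ a) * hR
      refine smul_right_injective _ (pow_ne_zero 2 hr0) ?_
      ext i j
      have h1 := congrFun hab i
      have h2 := congrArg conj (congrFun hab j)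
      simp only [Pi.smul_apply, smul_eq_mul, map_mul, conj_dotProduct_star] at h1 h2
      simp only [Matrix.smul_apply, vecMulVec_apply, Pi.star_apply, smul_eq_mul]
      simp only [starRingEnd_apply] at h2
      linear_combination a i * star (a j) * hR - (star a ⬝ᵥ a) * star (b j) * h1 -
        (star a ⬝ᵥ b) * a i * h2
  · right
    have hr0 : star b ⬝ᵥ b ≠ 0 := fun h => hR <| by
      have hb : b = 0 := dotProduct_star_self_eq_zero.1 h
      rw [hr, hb]
      simp
    have hr' : conj (star b ⬝ᵥ b) = star b ⬝ᵥ b := conj_dotProduct_star b b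
    obtain ⟨t, htdef⟩ : ∃ t, star b ⬝ᵥ (B *ᵥ b) = t * (star b ⬝ᵥ b) :=
      ⟨_, (div_mul_cancel₀ _ hr0).symm⟩
    have hag : star a ⬝ᵥ (Bᴴ *ᵥ a) = conj t * (star b ⬝ᵥ b) := by
      rw [dotProduct_mulVec, ← star_mulVec, ← conj_dotProduct_star, ht, htdef, map_mul, hr']
    have hag' : star (Bᴴ *ᵥ a) ⬝ᵥ a = t * (star b ⬝ᵥ b) := by
      rw [← conj_dotProduct_star, hag, map_mul, hr', Complex.conj_conj]
    have hbf' : star (B *ᵥ b) ⬝ᵥ b = conj t * (star b ⬝ᵥ b) := by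
      rw [← conj_dotProduct_star, htdef, map_mul, hr']
    have hs' : star (B *ᵥ b - t • b) ⬝ᵥ (B *ᵥ b - t • b) =
        star (Bᴴ *ᵥ a - conj t • a) ⬝ᵥ (Bᴴ *ᵥ a - conj t • a) := by
      simp only [star_sub, star_smul, sub_dotProduct, dotProduct_sub, smul_dotProduct,
        dotProduct_smul, smul_eq_mul, htdef, hag, hs, hag', hbf', hr]
      rw [← starRingEnd_apply (R := ℂ) t, ← starRingEnd_apply (R := ℂ) (conj t),
        Complex.conj_conj]
      ring
    have hx : star b ⬝ᵥ (Bᴴ *ᵥ a - conj t • a) = conj (star a ⬝ᵥ (B *ᵥ b - t • b)) := by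
      rw [conj_dotProduct_star, star_sub, star_smul, dotProduct_sub, sub_dotProduct,
        dotProduct_smul, smul_dotProduct, dotProduct_mulVec, ← star_mulVec,
        starRingEnd_apply]
    obtain ⟨ω, d, hω, hd⟩ := exists_unimodular_relation hr hs'
      (by rw [dotProduct_sub, dotProduct_smul, htdef, smul_eq_mul, sub_self])
      (by rw [dotProduct_sub, dotProduct_smul, hag, smul_eq_mul, hr, sub_self]) hx hR
    refine ⟨ω, d + t, hω, ?_⟩
    rw [map_add]
    linear_combination (norm := module) hd

end Dilation

theorem fromBlocks_normal {B : Matrix (Fin 3) (Fin 3) ℂ} {a b : Fin 3 → ℂ} {ω d : ℂ}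
    (H : Bᴴ * B + vecMulVec b (star b) = B * Bᴴ + vecMulVec a (star a)) (hω : conj ω * ω = 1)
    (hd : B *ᵥ b - d • b = ω • (Bᴴ *ᵥ a - conj d • a)) :
    (fromBlocks B (replicateCol Unit (ω • a)) (replicateRow Unit (star b))
        (d • (1 : Matrix Unit Unit ℂ)))ᴴ *
      fromBlocks B (replicateCol Unit (ω • a)) (replicateRow Unit (star b))
        (d • (1 : Matrix Unit Unit ℂ)) =
    fromBlocks B (replicateCol Unit (ω • a)) (replicateRow Unit (star b))
        (d • (1 : Matrix Unit Unit ℂ)) *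
      (fromBlocks B (replicateCol Unit (ω • a)) (replicateRow Unit (star b))
        (d • (1 : Matrix Unit Unit ℂ)))ᴴ := by
  have hω' : star ω * ω = 1 := hω
  have hr : star a ⬝ᵥ a = star b ⬝ᵥ b := by
    have h := congrArg Matrix.trace H
    rw [trace_add, trace_add, Matrix.trace_mul_comm, trace_vecMulVec, trace_vecMulVec,
      dotProduct_comm a, dotProduct_comm b] at h
    exact (add_left_cancel h).symm
  have hd' : ω • (Bᴴ *ᵥ a) + d • b = B *ᵥ b + ω • conj d • a := by
    linear_combination (norm := module) -hd
  rw [fromBlocks_conjTranspose, fromBlocks_multiply, fromBlocks_multiply]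
  have h12 : Bᴴ * replicateCol Unit (ω • a) +
      (replicateRow Unit (star b))ᴴ * (d • (1 : Matrix Unit Unit ℂ)) =
      B * (replicateRow Unit (star b))ᴴ +
        replicateCol Unit (ω • a) * (d • (1 : Matrix Unit Unit ℂ))ᴴ := by
    ext i j
    have h := congrFun hd' i
    simp only [Pi.add_apply, Pi.smul_apply, smul_eq_mul, mulVec, dotProduct, Finset.mul_sum] at h
    simp only [Matrix.add_apply, Matrix.mul_apply, replicateCol_apply, replicateRow_apply,
      conjTranspose_apply, Pi.smul_apply, Pi.star_apply, star_star, Matrix.smul_apply, smul_eq_mul,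
      Finset.univ_unique, Finset.sum_singleton, mul_left_comm _ ω] at h ⊢
    simp only [Matrix.one_apply_eq, mul_one]
    simp only [starRingEnd_apply] at h
    linear_combination h
  have h11 : (replicateRow Unit (star b))ᴴ * replicateRow Unit (star b) = vecMulVec b (star b) := by
    ext i j
    simp [Matrix.mul_apply, vecMulVec_apply]
  have h11' : replicateCol Unit (ω • a) * (replicateCol Unit (ω • a))ᴴ = vecMulVec a (star a) := by
    ext i j
    simp only [Matrix.mul_apply, vecMulVec_apply, replicateCol_apply, conjTranspose_apply,
      Pi.smul_apply, smul_eq_mul, Finset.univ_unique, Finset.sum_singleton, star_mul',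
      Pi.star_apply]
    linear_combination a i * star (a j) * hω'
  have h22 : (replicateCol Unit (ω • a))ᴴ * replicateCol Unit (ω • a) =
      replicateRow Unit (star b) * (replicateRow Unit (star b))ᴴ := by
    ext i j
    simp only [Matrix.mul_apply, replicateCol_apply, conjTranspose_apply, replicateRow_apply,
      Pi.smul_apply, smul_eq_mul, star_mul', Pi.star_apply, star_star]
    simp only [dotProduct, Pi.star_apply] at hr
    rw [← hr]
    refine Finset.sum_congr rfl fun x _ => ?_
    linear_combination a x * star (a x) * hω'
  have h21 := congrArg conjTranspose h12
  simp only [conjTranspose_add, conjTranspose_mul, conjTranspose_conjTranspose] at h21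
  rw [h11, h11', H, h12, h22, h21]
  congr 2
  simp [smul_comm d]

theorem separable_of_blocks {B : Matrix (Fin 3) (Fin 3) ℂ} {a b : Fin 3 → ℂ}
    (H : Bᴴ * B + vecMulVec b (star b) = B * Bᴴ + vecMulVec a (star a))
    {ρ : Matrix (Fin 3 × Fin 2) (Fin 3 × Fin 2) ℂ}
    (h00 : ∀ k l, ρ (k, 0) (l, 0) = (1 : Matrix (Fin 3) (Fin 3) ℂ) k l)
    (h01 : ∀ k l, ρ (k, 0) (l, 1) = B k l) (h10 : ∀ k l, ρ (k, 1) (l, 0) = Bᴴ k l)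
    (h11 : ∀ k l, ρ (k, 1) (l, 1) = (Bᴴ * B + vecMulVec b (star b)) k l) : Separable ρ := by
  rcases exists_dilation H with hab | ⟨ω, d, hω, hd⟩
  · have hN : Bᴴ * B = B * Bᴴ := by
      rw [hab] at H
      exact add_right_cancel H
    have h0 : Separable (ρ - prodProj b (Pi.single 1 1)) := by
      refine separable_of_normal hN id ?_
      intro k i l j
      fin_cases i <;> fin_cases j <;>
        simp [prodProj_apply, h00, h01, h10, h11, vecMulVec_apply]
    simpa using h0.add (separable_prodProj b (Pi.single 1 1))
  · refine separable_of_normal (fromBlocks_normal H hω hd) Sum.inl ?_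
    intro k i l j
    fin_cases i <;> fin_cases j
    · simp [h00, Matrix.one_apply]
    · simp [h01]
    · simp [h10]
    · simp only [Fin.mk_one, h11, pow_one]
      rw [fromBlocks_conjTranspose, fromBlocks_multiply, fromBlocks_apply₁₁]
      simp [Matrix.add_apply, Matrix.mul_apply, vecMulVec_apply]

theorem exists_ne_zero_mulVec_eq_zero {k l : ℕ} (h : k < l) (M : Matrix (Fin k) (Fin l) ℂ) :
    ∃ v, v ≠ 0 ∧ M *ᵥ v = 0 := by
  have h1 : LinearMap.ker M.mulVecLin ≠ ⊥ :=
    LinearMap.ker_ne_bot_of_finrank_lt (by simpa using h)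
  obtain ⟨v, hv, hv0⟩ := (Submodule.ne_bot_iff _).1 h1
  exact ⟨v, hv0, hv⟩

theorem exists_conjTranspose_mul_self_eq_add {C₀ : Matrix (Fin 4) (Fin 3) ℂ} (h : C₀ᴴ * C₀ = 1)
    (C₁ : Matrix (Fin 4) (Fin 3) ℂ) :
    ∃ b, C₁ᴴ * C₁ = (C₀ᴴ * C₁)ᴴ * (C₀ᴴ * C₁) + vecMulVec b (star b) := by
  obtain ⟨v, hv, hv0⟩ := exists_ne_zero_mulVec_eq_zero (by norm_num) C₀ᴴ
  obtain ⟨r, hr, hu⟩ := exists_normalization hv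
  set u := r • v
  have hu0 : C₀ᴴ *ᵥ u = 0 := by rw [mulVec_smul, hv0, smul_zero]
  let U := fromCols C₀ (replicateCol Unit u)
  have h1 : Uᴴ * U = 1 := by
    have e1 : C₀ᴴ * replicateCol Unit u = 0 := by
      ext i j
      exact congrFun hu0 i
    have e2 : (replicateCol Unit u)ᴴ * replicateCol Unit u = 1 := by
      ext i j
      simpa [Matrix.mul_apply, dotProduct] using hu
    have e3 : (replicateCol Unit u)ᴴ * C₀ = 0 := by
      rw [← conjTranspose_conjTranspose C₀, ← conjTranspose_mul, e1, conjTranspose_zero]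
    rw [conjTranspose_fromCols_eq_fromRows_conjTranspose, fromRows_mul_fromCols, h, e1, e2, e3,
      fromBlocks_one]
  have h2 : U * Uᴴ = 1 := (mul_eq_one_comm_of_card_eq _ _ _ (by simp)).1 h1
  rw [conjTranspose_fromCols_eq_fromRows_conjTranspose, fromCols_mul_fromRows] at h2
  refine ⟨C₁ᴴ *ᵥ u, ?_⟩
  have h3 : replicateCol Unit u * (replicateCol Unit u)ᴴ = vecMulVec u (star u) := by
    ext i j
    simp [Matrix.mul_apply, vecMulVec_apply]
  rw [← mul_vecMulVec, star_mulVec, conjTranspose_conjTranspose]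
  rw [← vecMulVec_mul, ← h3, conjTranspose_mul, conjTranspose_conjTranspose]
  rw [Matrix.mul_assoc C₁ᴴ, ← Matrix.mul_assoc C₀, ← Matrix.mul_assoc _ _ C₁, Matrix.mul_assoc,
    ← Matrix.mul_add, ← Matrix.add_mul, h2, Matrix.one_mul]

theorem separable_of_factorizations {ρ : Matrix (Fin 3 × Fin 2) (Fin 3 × Fin 2) ℂ}
    {C C' : Matrix (Fin 4) (Fin 3 × Fin 2) ℂ} (hC : ρ = Cᴴ * C) (hC' : pt ρ = C'ᴴ * C')
    (h00 : ∀ k l, ρ (k, 0) (l, 0) = (1 : Matrix (Fin 3) (Fin 3) ℂ) k l) : Separable ρ := by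
  have key : ∀ (D : Matrix (Fin 4) (Fin 3 × Fin 2) ℂ) i j k l, (Dᴴ * D) (k, i) (l, j) =
    ((D.submatrix id (·, i))ᴴ * D.submatrix id (·, j)) k l := fun _ _ _ _ _ => rfl
  have hpt : ∀ i j k l, ρ (k, i) (l, j) = pt ρ (l, i) (k, j) := fun _ _ _ _ => rfl
  have e0 : (C.submatrix id (·, 0))ᴴ * C.submatrix id (·, 0) = 1 := by
    ext k l
    rw [← key, ← hC, h00]
  have e0' : (C'.submatrix id (·, 0))ᴴ * C'.submatrix id (·, 0) = 1 := by
    ext k l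
    rw [← key, ← hC', ← hpt, h00, Matrix.one_apply, Matrix.one_apply]
    simp only [eq_comm]
  obtain ⟨b, hb⟩ := exists_conjTranspose_mul_self_eq_add e0 (C.submatrix id (·, 1))
  obtain ⟨a, ha⟩ := exists_conjTranspose_mul_self_eq_add e0' (C'.submatrix id (·, 1))
  set B := (C.submatrix id (·, 0))ᴴ * C.submatrix id (·, 1)
  have hB : (C'.submatrix id (·, 0))ᴴ * C'.submatrix id (·, 1) = Bᵀ := by
    ext k l
    rw [← key, ← hC', ← hpt, hC, key, transpose_apply]
  have hD : (C.submatrix id (·, 1))ᴴ * C.submatrix id (·, 1) =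
      ((C'.submatrix id (·, 1))ᴴ * C'.submatrix id (·, 1))ᵀ := by
    ext k l
    rw [transpose_apply, ← key, ← key, ← hC, ← hC', ← hpt]
  refine separable_of_blocks (B := B) (a := star a) (b := b) ?_ h00 (fun k l => ?_)
    (fun k l => ?_) fun k l => ?_
  · rw [← hb, hD, ha, hB, transpose_add, transpose_mul, transpose_transpose,
      transpose_vecMulVec, star_star]
    rfl
  · rw [hC, key]
  · rw [hC, key, conjTranspose_mul, conjTranspose_conjTranspose]
  · rw [hC, key, hb]

theorem Matrix.PosSemidef.exists_factorization_of_rank_eq [DecidableEq ι] {ρ : Matrix ι ι ℂ}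
    (hρ : ρ.PosSemidef) {r : ℕ} (hr : ρ.rank = r) :
    ∃ (C : Matrix (Fin r) ι ℂ) (R : Matrix ι (Fin r) ℂ), ρ = Cᴴ * C ∧ C * R = 1 := by
  subst hr
  exact hρ.exists_factorization

theorem conjTranspose_mul_mul_kronecker_inv {P Q : Matrix (Fin n) (Fin n) ℂ}
    {P' Q' : Matrix (Fin m) (Fin m) ℂ} (h : P * Q = 1) (h' : P' * Q' = 1)
    (ρ : Matrix (Fin n × Fin m) (Fin n × Fin m) ℂ) :
    (Q ⊗ₖ Q')ᴴ * ((P ⊗ₖ P')ᴴ * ρ * (P ⊗ₖ P')) * (Q ⊗ₖ Q') = ρ := by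
  have h1 : (P ⊗ₖ P') * (Q ⊗ₖ Q') = 1 := by
    rw [← mul_kronecker_mul, h, h', one_kronecker_one]
  rw [Matrix.mul_assoc, Matrix.mul_assoc, h1, Matrix.mul_one, ← Matrix.mul_assoc,
    ← conjTranspose_mul, h1, conjTranspose_one, Matrix.one_mul]

theorem allSep_three_two : AllSep 3 2 := by
  refine allSep_succ_two allSep_two_two fun ρ hρ h1 h2 h3 => ?_
  have hr : ρ.rank = 4 := by nlinarith
  have hr' : (pt ρ).rank = 4 := by nlinarith
  obtain ⟨C, -, hC, -⟩ := hρ.1.exists_factorization_of_rank_eq hr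
  obtain ⟨C', -, hC', -⟩ := hρ.2.exists_factorization_of_rank_eq hr'
  set C₀ := C.submatrix id (·, (0 : Fin 2)) with hC₀
  have hsl : ∀ φ, C₀ *ᵥ φ = C *ᵥ prodVec φ (Pi.single 0 1) := fun φ => by
    ext i
    simp [hC₀, mulVec, dotProduct, Fintype.sum_prod_type, prodVec]
  by_cases hdet : (C₀ᴴ * C₀).det = 0
  · obtain ⟨φ, hφ, h0⟩ := exists_mulVec_eq_zero_iff.2 hdet
    rw [conjTranspose_mul_self_mulVec_eq_zero, hsl] at h0
    rw [hC] at hρ ⊢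
    exact separable_of_kernel_two allSep_two_two hρ hφ (by simp) h0
  · have hX : (C₀ᴴ * C₀).rank = 3 := by
      rw [rank_of_isUnit _ ((isUnit_iff_isUnit_det _).2 (isUnit_iff_ne_zero.2 hdet)),
        Fintype.card_fin]
    obtain ⟨Y, R, hY, hYR⟩ :=
      (posSemidef_conjTranspose_mul_self C₀).exists_factorization_of_rank_eq hX
    have hRY : R * Y = 1 := mul_eq_one_comm.1 hYR
    have hs : Separable ((R ⊗ₖ (1 : Matrix (Fin 2) (Fin 2) ℂ))ᴴ * ρ *
        (R ⊗ₖ (1 : Matrix (Fin 2) (Fin 2) ℂ))) := by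
      refine separable_of_factorizations (C := C * (R ⊗ₖ (1 : Matrix (Fin 2) (Fin 2) ℂ)))
        (C' := C' * (R.map star ⊗ₖ (1 : Matrix (Fin 2) (Fin 2) ℂ))) ?_ ?_
        fun k l => ?_
      · rw [hC, conjTranspose_mul]
        simp only [Matrix.mul_assoc]
      · rw [pt_kronecker_congr, hC', conjTranspose_mul]
        simp only [Matrix.mul_assoc]
      · have e : (C * (R ⊗ₖ (1 : Matrix (Fin 2) (Fin 2) ℂ))).submatrix id (·, 0) = C₀ * R := by
          ext i j
          simp [hC₀, Matrix.mul_apply, Fintype.sum_prod_type, Matrix.one_apply]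
        have e2 : Rᴴ * (C₀ᴴ * C₀) * R = 1 := by
          rw [hY, ← Matrix.mul_assoc, Matrix.mul_assoc _ Y, hYR, Matrix.mul_one,
            ← conjTranspose_mul, hYR, conjTranspose_one]
        have e3 : ∀ K : Matrix (Fin 3 × Fin 2) (Fin 3 × Fin 2) ℂ,
            Kᴴ * (Cᴴ * C) * K = (C * K)ᴴ * (C * K) := fun K => by
          rw [conjTranspose_mul]
          simp only [Matrix.mul_assoc]
        have e4 : (C₀ * R)ᴴ * (C₀ * R) = 1 := by
          rw [← e2, conjTranspose_mul]
          simp only [Matrix.mul_assoc]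
        rw [hC, e3, ← e4, ← e]
        rfl
    have := hs.congr_kronecker Y (1 : Matrix (Fin 2) (Fin 2) ℂ)
    rwa [conjTranspose_mul_mul_kronecker_inv hRY (Matrix.one_mul 1)] at this

theorem allSep_two_three : AllSep 2 3 := allSep_three_two.swap

section Segre

open MvPolynomial

/-- The Segre parametrization `X (i, j) ↦ x_i y_j`. -/
noncomputable def segre : MvPolynomial (Fin 3 × Fin 3) ℂ →ₐ[ℂ] MvPolynomial (Fin 3 ⊕ Fin 3) ℂ :=
  aeval fun p => X (Sum.inl p.1) * X (Sum.inr p.2)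

/-- Set `x_i = 0` for `i ≥ a` and `y_j = 0` for `j ≥ b`. -/
noncomputable def truncate (a b : ℕ) :
    MvPolynomial (Fin 3 ⊕ Fin 3) ℂ →ₐ[ℂ] MvPolynomial (Fin 3 ⊕ Fin 3) ℂ :=
  aeval (Sum.elim (fun i => if (i : ℕ) < a then X (Sum.inl i) else 0)
    (fun j => if (j : ℕ) < b then X (Sum.inr j) else 0))

/-- The prime of the Segre coordinate ring cut out by a truncation. -/
noncomputable def truncateIdeal (a b : ℕ) : Ideal segre.range :=
  RingHom.ker ((truncate a b).comp segre.range.val)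

instance (a b : ℕ) : (truncateIdeal a b).IsPrime := RingHom.ker_isPrime _

instance : IsNoetherianRing segre.range :=
  isNoetherianRing_of_surjective _ _ segre.rangeRestrict.toRingHom segre.rangeRestrict_surjective

theorem truncate_truncate {a b a' b' : ℕ} (ha : a' ≤ a) (hb : b' ≤ b)
    (p : MvPolynomial (Fin 3 ⊕ Fin 3) ℂ) : truncate a' b' (truncate a b p) = truncate a' b' p := by
  suffices (truncate a' b').comp (truncate a b) = truncate a' b' from DFunLike.congr_fun this p
  ext1 s
  rcases s with i | j
  · by_cases h : (i : ℕ) < a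
    · simp [truncate, h]
    · simp [truncate, h, if_neg fun h' : (i : ℕ) < a' => h (h'.trans_le ha)]
  · by_cases h : (j : ℕ) < b
    · simp [truncate, h]
    · simp [truncate, h, if_neg fun h' : (j : ℕ) < b' => h (h'.trans_le hb)]

theorem truncateIdeal_lt {a b a' b' : ℕ} (ha : a' ≤ a) (hb : b' ≤ b) (i j : Fin 3)
    (h : (i : ℕ) < a ∧ (j : ℕ) < b) (h' : ¬((i : ℕ) < a' ∧ (j : ℕ) < b')) :
    truncateIdeal a b < truncateIdeal a' b' := by
  refine lt_of_le_of_ne (fun q hq => ?_) fun heq => ?_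
  · have hq' : truncate a b q = 0 := hq
    change truncate a' b' q = 0
    rw [← truncate_truncate ha hb, hq', map_zero]
  · have key : ∀ c d, truncate c d (segre (X (i, j))) =
        (if (i : ℕ) < c then X (Sum.inl i) else 0) * (if (j : ℕ) < d then X (Sum.inr j) else 0) :=
      fun c d => by simp [truncate, segre]
    have h1 : segre.rangeRestrict (X (i, j)) ∈ truncateIdeal a' b' := by
      change truncate a' b' (segre _) = 0
      rw [key]
      rcases not_and_or.1 h' with h' | h' <;> simp [h']
    rw [← heq] at h1
    change truncate a b (segre _) = 0 at h1
    rw [key, if_pos h.1, if_pos h.2] at h1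
    exact mul_ne_zero (X_ne_zero _) (X_ne_zero _) h1

theorem five_le_height : 5 ≤ (truncateIdeal 0 0).height := by
  have h1 := Ideal.height_add_one_le_of_lt_of_isPrime
    (truncateIdeal_lt (a := 3) (b := 3) (a' := 3) (b' := 2) le_rfl (by simp) 0 2 (by simp) (by simp))
  have h2 := Ideal.height_add_one_le_of_lt_of_isPrime
    (truncateIdeal_lt (a := 3) (b := 2) (a' := 3) (b' := 1) le_rfl (by simp) 0 1 (by simp) (by simp))
  have h3 := Ideal.height_add_one_le_of_lt_of_isPrime
    (truncateIdeal_lt (a := 3) (b := 1) (a' := 2) (b' := 1) (by simp) le_rfl 2 0 (by simp) (by simp))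
  have h4 := Ideal.height_add_one_le_of_lt_of_isPrime
    (truncateIdeal_lt (a := 2) (b := 1) (a' := 1) (b' := 1) (by simp) le_rfl 1 0 (by simp) (by simp))
  have h5 := Ideal.height_add_one_le_of_lt_of_isPrime
    (truncateIdeal_lt (a := 1) (b := 1) (a' := 0) (b' := 0) (by simp) (by simp) 0 0 (by simp)
      (by simp))
  calc (5 : ℕ∞) = 0 + 1 + 1 + 1 + 1 + 1 := by norm_num
    _ ≤ (truncateIdeal 3 3).height + 1 + 1 + 1 + 1 + 1 := by gcongr; exact zero_le
    _ ≤ (truncateIdeal 3 2).height + 1 + 1 + 1 + 1 := by gcongr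
    _ ≤ (truncateIdeal 3 1).height + 1 + 1 + 1 := by gcongr
    _ ≤ (truncateIdeal 2 1).height + 1 + 1 := by gcongr
    _ ≤ (truncateIdeal 1 1).height + 1 := by gcongr
    _ ≤ _ := h5

theorem exists_kernel_prodVec (C : Matrix (Fin 4) (Fin 3 × Fin 3) ℂ) :
    ∃ φ ψ, φ ≠ 0 ∧ ψ ≠ 0 ∧ C *ᵥ prodVec φ ψ = 0 := by
  by_contra! hno
  let L : Fin 4 → MvPolynomial (Fin 3 × Fin 3) ℂ := fun k => ∑ p, MvPolynomial.C (C k p) * X p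
  have hL : ∀ k x, aeval x (L k) = (C *ᵥ x) k := fun k x => by
    simp [L, mulVec, dotProduct]
  let s : Finset segre.range := Finset.univ.image fun k => segre.rangeRestrict (L k)
  have hs : s.card ≤ 4 := Finset.card_image_le.trans (by simp)
  have htr : ∀ f, truncate 0 0 (segre f) = MvPolynomial.C (aeval (0 : Fin 3 × Fin 3 → ℂ) f) := by
    intro f
    have : (truncate 0 0).comp segre = (Algebra.ofId ℂ _).comp
        (aeval (0 : Fin 3 × Fin 3 → ℂ)) := by
      ext1 p
      simp [truncate, segre]
    exact DFunLike.congr_fun this f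
  have hmin : truncateIdeal 0 0 ∈ (Ideal.span (s : Set segre.range)).minimalPrimes := by
    refine ⟨⟨inferInstance, Ideal.span_le.2 fun q hq => ?_⟩, fun p ⟨hp, hsp⟩ _ q hq => ?_⟩
    · obtain ⟨k, -, rfl⟩ := Finset.mem_image.1 (Finset.mem_coe.1 hq)
      change truncate 0 0 (segre _) = 0
      rw [htr, hL, mulVec_zero, Pi.zero_apply, map_zero]
    · let P := p.comap segre.rangeRestrict
      have hP : P.IsPrime := Ideal.IsPrime.comap _
      have hker : ∀ f, segre f = 0 → f ∈ P := fun f hf => by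
        have : segre.rangeRestrict f = 0 := Subtype.ext hf
        change segre.rangeRestrict f ∈ p
        rw [this]
        exact p.zero_mem
      have hzero : zeroLocus ℂ P ⊆ {0} := by
        intro x hx
        by_contra hx0
        obtain ⟨⟨i₀, j₀⟩, h0⟩ := Function.ne_iff.1 hx0
        have hminor : ∀ i j, x (i, j) * x (i₀, j₀) = x (i, j₀) * x (i₀, j) := fun i j => by
          have := hx (X (i, j) * X (i₀, j₀) - X (i, j₀) * X (i₀, j))
            (hker _ (by simp [segre]; ring))
          simpa [sub_eq_zero] using this
        have hxe : x = prodVec (fun i => x (i, j₀)) (fun j => x (i₀, j) / x (i₀, j₀)) := by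
          ext ⟨i, j⟩
          rw [prodVec, mul_div_assoc', ← hminor, mul_div_cancel_right₀ _ h0]
        refine hno (fun i => x (i, j₀)) (fun j => x (i₀, j) / x (i₀, j₀)) (fun h => ?_)
          (fun h => ?_) ?_
        · exact h0 (congrFun h i₀)
        · exact one_ne_zero ((div_self h0).symm.trans (congrFun h j₀))
        · rw [← hxe]
          ext k
          rw [← hL]
          exact hx _ (hsp (Ideal.subset_span
            (Finset.mem_coe.2 (Finset.mem_image_of_mem _ (Finset.mem_univ k)))))
      obtain ⟨f, rfl⟩ := segre.rangeRestrict_surjective q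
      have hf : truncate 0 0 (segre f) = 0 := hq
      rw [htr, map_eq_zero_iff _ (C_injective _ _)] at hf
      have hfP : f ∈ P := by
        rw [← IsPrime.vanishingIdeal_zeroLocus (K := ℂ) P]
        exact fun x hx => by rw [hzero hx, hf]
      exact hfP
  have h4 := Ideal.height_le_card_of_mem_minimalPrimes_span_finset hmin
  have h5 : (5 : ℕ∞) ≤ (4 : ℕ) := five_le_height.trans (h4.trans (by exact_mod_cast hs))
  norm_cast at h5

end Segre

/-- The kernel of `C` contains exactly six product vectors up to scalars. -/
def SixKernelProducts (C : Matrix ι (Fin 3 × Fin 3) ℂ) : Prop :=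
  ∃ Φ Ψ : Fin 6 → Fin 3 → ℂ,
    (∀ t, Φ t ≠ 0 ∧ Ψ t ≠ 0 ∧ C *ᵥ prodVec (Φ t) (Ψ t) = 0) ∧
    (∀ t t', t ≠ t' → ∀ c : ℂ, prodVec (Φ t) (Ψ t) ≠ c • prodVec (Φ t') (Ψ t')) ∧
    ∀ φ ψ, φ ≠ 0 → ψ ≠ 0 → C *ᵥ prodVec φ ψ = 0 →
      ∃ (t : Fin 6) (c : ℂ), prodVec φ ψ = c • prodVec (Φ t) (Ψ t)

theorem mulVec_ne_zero_of_mul_eq_one [DecidableEq κ] {P : Matrix ι κ ℂ} {P' : Matrix κ ι ℂ}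
    (h : P' * P = 1) {v : κ → ℂ} (hv : v ≠ 0) : P *ᵥ v ≠ 0 := fun h0 => hv <| by
  rw [← one_mulVec v, ← h, ← mulVec_mulVec, h0, mulVec_zero]

theorem SixKernelProducts.of_congr {C : Matrix ι (Fin 3 × Fin 3) ℂ} [DecidableEq ι]
    {O : Matrix κ ι ℂ} {O' : Matrix ι κ ℂ} (hO : O' * O = 1) {P Q P' Q' : Matrix (Fin 3) (Fin 3) ℂ}
    (hP : P * P' = 1) (hQ : Q * Q' = 1) (h : SixKernelProducts (O * C * (P ⊗ₖ Q))) :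
    SixKernelProducts C := by
  have key : ∀ φ ψ, (O * C * (P ⊗ₖ Q)) *ᵥ prodVec φ ψ = O *ᵥ (C *ᵥ prodVec (P *ᵥ φ) (Q *ᵥ ψ)) :=
    fun φ ψ => by
      rw [← mulVec_mulVec, ← mulVec_mulVec, kronecker_mulVec_prodVec]
  have hP' := mul_eq_one_comm.1 hP
  have hQ' := mul_eq_one_comm.1 hQ
  obtain ⟨Φ, Ψ, h1, h2, h3⟩ := h
  refine ⟨fun t => P *ᵥ Φ t, fun t => Q *ᵥ Ψ t, fun t => ⟨?_, ?_, ?_⟩, fun t t' htt c hc => ?_,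
    fun φ ψ hφ hψ h0 => ?_⟩
  · exact mulVec_ne_zero_of_mul_eq_one hP' (h1 t).1
  · exact mulVec_ne_zero_of_mul_eq_one hQ' (h1 t).2.1
  · by_contra hne
    refine mulVec_ne_zero_of_mul_eq_one hO hne ?_
    rw [← key, (h1 t).2.2]
  · refine h2 t t' htt c ?_
    have h := congrArg ((P' ⊗ₖ Q') *ᵥ ·) hc
    simpa [mulVec_smul, kronecker_mulVec_prodVec, hP', hQ'] using h
  · obtain ⟨t, c, hc⟩ := h3 (P' *ᵥ φ) (Q' *ᵥ ψ) (mulVec_ne_zero_of_mul_eq_one hP hφ)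
      (mulVec_ne_zero_of_mul_eq_one hQ hψ) (by
        rw [key, mulVec_mulVec φ, mulVec_mulVec ψ, hP, hQ, one_mulVec, one_mulVec, h0, mulVec_zero])
    refine ⟨t, c, ?_⟩
    have h := congrArg ((P ⊗ₖ Q) *ᵥ ·) hc
    simpa [mulVec_smul, kronecker_mulVec_prodVec, hP, hQ] using h

theorem separable_of_congr {P Q P' Q' : Matrix (Fin 3) (Fin 3) ℂ} [DecidableEq ι]
    {C : Matrix ι (Fin 3 × Fin 3) ℂ} {O : Matrix κ ι ℂ} (hO : Oᴴ * O = 1)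
    (hP : P * P' = 1) (hQ : Q * Q' = 1)
    (h : Separable ((O * C * (P ⊗ₖ Q))ᴴ * (O * C * (P ⊗ₖ Q)))) : Separable (Cᴴ * C) := by
  have e : (O * C * (P ⊗ₖ Q))ᴴ * (O * C * (P ⊗ₖ Q)) = (P ⊗ₖ Q)ᴴ * (Cᴴ * C) * (P ⊗ₖ Q) := by
    rw [conjTranspose_mul, conjTranspose_mul, Matrix.mul_assoc, Matrix.mul_assoc,
      ← Matrix.mul_assoc Oᴴ, ← Matrix.mul_assoc Oᴴ, hO, Matrix.one_mul, Matrix.mul_assoc,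
      Matrix.mul_assoc]
  rw [e] at h
  have := h.congr_kronecker P' Q'
  rwa [conjTranspose_mul_mul_kronecker_inv hP hQ] at this

theorem PPT.congr_mul {P Q : Matrix (Fin n) (Fin n) ℂ} [DecidableEq ι]
    {C : Matrix ι (Fin n × Fin n) ℂ} {O : Matrix κ ι ℂ} (hO : Oᴴ * O = 1) (h : PPT (Cᴴ * C)) :
    PPT ((O * C * (P ⊗ₖ Q))ᴴ * (O * C * (P ⊗ₖ Q))) := by
  have e : (O * C * (P ⊗ₖ Q))ᴴ * (O * C * (P ⊗ₖ Q)) = (P ⊗ₖ Q)ᴴ * (Cᴴ * C) * (P ⊗ₖ Q) := by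
    rw [conjTranspose_mul, conjTranspose_mul, Matrix.mul_assoc, Matrix.mul_assoc,
      ← Matrix.mul_assoc Oᴴ, ← Matrix.mul_assoc Oᴴ, hO, Matrix.one_mul, Matrix.mul_assoc,
      Matrix.mul_assoc]
  rw [e]
  exact h.congr_kronecker P Q

section NonSeparable

variable [DecidableEq ι] {C : Matrix ι (Fin 3 × Fin 3) ℂ}

theorem two_le_rank_rSlice (hC : PPT (Cᴴ * C)) (hs : ¬Separable (Cᴴ * C)) {φ : Fin 3 → ℂ}
    (hφ : φ ≠ 0) : 2 ≤ (rSlice C φ).rank := by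
  by_contra! h
  obtain ⟨f, hf⟩ := finrank_le_one_iff.1 (Nat.lt_succ_iff.1 h)
  refine hs (separable_of_rank_le_one allSep_two_three hC hφ ⟨f, fun y => ?_⟩)
  obtain ⟨c, hc⟩ := hf ⟨rSlice C φ *ᵥ y, y, rfl⟩
  exact ⟨c, by rw [← rSlice_mulVec]; exact (congrArg Subtype.val hc).symm⟩

theorem rank_rSlice (hC : PPT (Cᴴ * C)) (hs : ¬Separable (Cᴴ * C)) {φ ψ : Fin 3 → ℂ}
    (hφ : φ ≠ 0) (hψ : ψ ≠ 0) (h : C *ᵥ prodVec φ ψ = 0) : (rSlice C φ).rank = 2 ∧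
      ∀ y, C *ᵥ prodVec φ y = 0 → ∃ a : ℂ, y = a • ψ := by
  have h2 := two_le_rank_rSlice hC hs hφ
  have h3 := (rSlice C φ).mulVecLin.finrank_range_add_finrank_ker
  have hmem : ψ ∈ LinearMap.ker (rSlice C φ).mulVecLin := by
    simpa [rSlice_mulVec] using h
  have h1 : Module.finrank ℂ (LinearMap.ker (rSlice C φ).mulVecLin) ≠ 0 := fun h0 => by
    rw [Submodule.finrank_eq_zero] at h0
    rw [h0] at hmem
    exact hψ hmem
  simp only [Module.finrank_fintype_fun_eq_card, Fintype.card_fin] at h3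
  change (rSlice C φ).rank + _ = 3 at h3
  have hk : Module.finrank ℂ (LinearMap.ker (rSlice C φ).mulVecLin) = 1 := by omega
  refine ⟨by omega, fun y hy => ?_⟩
  obtain ⟨a, ha⟩ := (finrank_eq_one_iff_of_nonzero'
    (⟨ψ, hmem⟩ : LinearMap.ker (rSlice C φ).mulVecLin)
    (fun h => hψ (congrArg Subtype.val h))).1 hk ⟨y, by simpa [rSlice_mulVec] using hy⟩
  exact ⟨a, (congrArg Subtype.val ha).symm⟩

end NonSeparable

/-- Exchange of the two tensor factors. -/
def swapFactors {α : Type*} (C : Matrix α (Fin n × Fin m) ℂ) : Matrix α (Fin m × Fin n) ℂ :=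
  C.submatrix id Prod.swap

theorem swapFactors_mulVec {α : Type*} (C : Matrix α (Fin n × Fin m) ℂ)
    (x : Fin n → ℂ) (y : Fin m → ℂ) :
    swapFactors C *ᵥ prodVec y x = C *ᵥ prodVec x y := by
  ext i
  simp only [swapFactors, mulVec, dotProduct, submatrix_apply, id, prodVec]
  exact Fintype.sum_equiv (Equiv.prodComm _ _) _ _ fun p => by simp [mul_comm]

theorem PPT.swapFactors {C : Matrix ι (Fin n × Fin m) ℂ} (hC : PPT (Cᴴ * C)) :
    PPT ((_root_.swapFactors C)ᴴ * _root_.swapFactors C) := hC.swap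

theorem separable_of_swapFactors {C : Matrix ι (Fin n × Fin m) ℂ}
    (h : Separable ((swapFactors C)ᴴ * swapFactors C)) : Separable (Cᴴ * C) := h.swap

theorem rSlice_swapFactors {α : Type*} (C : Matrix α (Fin n × Fin m) ℂ)
    (y : Fin m → ℂ) (x : Fin n → ℂ) :
    rSlice (swapFactors C) y *ᵥ x = C *ᵥ prodVec x y := by
  rw [rSlice_mulVec, swapFactors_mulVec]

theorem exists_normalForm {C : Matrix (Fin 4) (Fin 3 × Fin 3) ℂ} (hC : PPT (Cᴴ * C))
    (hs : ¬Separable (Cᴴ * C)) : ∃ (O : Matrix (Fin 2 ⊕ Fin 2) (Fin 4) ℂ)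
      (P Q P' Q' : Matrix (Fin 3) (Fin 3) ℂ), Oᴴ * O = 1 ∧ P * P' = 1 ∧ Q * Q' = 1 ∧
      (∀ t y, (O * C * (P ⊗ₖ Q)) *ᵥ prodVec (vecCons 1 0) (vecCons t y) =
        Sum.elim y (0 : Fin 2 → ℂ)) ∧
      ∀ s x, (O * C * (P ⊗ₖ Q)) *ᵥ prodVec (vecCons s x) (vecCons 1 0) =
        Sum.elim (0 : Fin 2 → ℂ) x := by
  obtain ⟨φ, ψ, hφ, hψ, h0⟩ := exists_kernel_prodVec C
  have slice : ∀ {M : Matrix (Fin 4) (Fin 3) ℂ} {v : Fin 3 → ℂ}, M.rank = 2 → v ≠ 0 →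
      M *ᵥ v = 0 → ∃ R : Matrix (Fin 3) (Fin 2) ℂ, ∃ Q Q' : Matrix (Fin 3) (Fin 3) ℂ,
        (M * R)ᴴ * (M * R) = 1 ∧ Q * Q' = 1 ∧ ∀ t y, Q *ᵥ vecCons t y = t • v + R *ᵥ y := by
    intro M v hM hv hMv
    obtain ⟨Y, R, hY, hYR⟩ := (posSemidef_conjTranspose_mul_self M).exists_factorization_of_rank_eq
      ((rank_conjTranspose_mul_self M).trans hM)
    have hR : (M * R)ᴴ * (M * R) = 1 := by
      rw [conjTranspose_mul, Matrix.mul_assoc, ← Matrix.mul_assoc Mᴴ, hY, Matrix.mul_assoc, hYR,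
        Matrix.mul_one, ← conjTranspose_mul, hYR, conjTranspose_one]
    let Q : Matrix (Fin 3) (Fin 3) ℂ := of fun i => vecCons (v i) (R i)
    have hQ : ∀ t y, Q *ᵥ vecCons t y = t • v + R *ᵥ y := fun t y => by
      ext i
      simp [Q, mulVec, dotProduct_cons, mul_comm]
    have hdet : Q.det ≠ 0 := fun h => by
      obtain ⟨w, hw, hw0⟩ := exists_mulVec_eq_zero_iff.2 h
      obtain ⟨t, y, rfl⟩ : ∃ t y, w = vecCons t y := ⟨_, _, (cons_head_tail w).symm⟩
      rw [hQ] at hw0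
      have h1 := congrArg (fun z => (M * R)ᴴ *ᵥ (M *ᵥ z)) hw0
      simp only [mulVec_add, mulVec_smul, hMv, smul_zero, zero_add, mulVec_zero] at h1
      rw [mulVec_mulVec y, mulVec_mulVec, hR, one_mulVec] at h1
      subst h1
      rw [mulVec_zero, add_zero] at hw0
      have ht := (smul_eq_zero.1 hw0).resolve_right hv
      exact hw (by rw [ht]; simp)
    exact ⟨R, Q, Q⁻¹, hR, Matrix.mul_nonsing_inv _ (isUnit_iff_ne_zero.2 hdet), hQ⟩
  obtain ⟨R, Q, Q', hR, hQQ, hQ⟩ := slice (rank_rSlice hC hs hφ hψ h0).1 hψ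
    (by rw [rSlice_mulVec, h0])
  obtain ⟨S, P, P', hS, hPP, hP⟩ := slice (rank_rSlice hC.swapFactors
    (fun h => hs (separable_of_swapFactors h)) hψ hφ (by rw [swapFactors_mulVec, h0])).1 hφ
    (by rw [rSlice_swapFactors, h0])
  set M := rSlice C φ
  set N := rSlice (swapFactors C) ψ
  have hMN : (M * R)ᴴ * (N * S) = 0 := by
    ext i j
    have h := hC.orthogonal h0 (S *ᵥ Pi.single j 1) (R *ᵥ Pi.single i 1)
    rw [← rSlice_mulVec, ← rSlice_swapFactors, mulVec_mulVec, mulVec_mulVec, mulVec_single_one,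
      mulVec_single_one] at h
    exact h
  have hNM : (N * S)ᴴ * (M * R) = 0 := by
    rw [← conjTranspose_conjTranspose (M * R), ← conjTranspose_mul, hMN, conjTranspose_zero]
  let U := fromCols (M * R) (N * S)
  have hU : Uᴴ * U = 1 := by
    rw [conjTranspose_fromCols_eq_fromRows_conjTranspose, fromRows_mul_fromCols, hR, hS, hMN, hNM,
      fromBlocks_one]
  have hU' : U * Uᴴ = 1 := (mul_eq_one_comm_of_card_eq _ _ _ (by simp)).1 hU
  have key : ∀ x y, (Uᴴ * C * (P ⊗ₖ Q)) *ᵥ prodVec x y =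
      Uᴴ *ᵥ (C *ᵥ prodVec (P *ᵥ x) (Q *ᵥ y)) := fun x y => by
    rw [← mulVec_mulVec, ← mulVec_mulVec, kronecker_mulVec_prodVec]
  refine ⟨Uᴴ, P, Q, P', Q', by rw [conjTranspose_conjTranspose, hU'], hPP, hQQ, fun t y => ?_,
    fun s x => ?_⟩
  · have e : C *ᵥ prodVec φ (R *ᵥ y) = (M * R) *ᵥ y := by
      rw [← rSlice_mulVec, mulVec_mulVec]
    rw [key, hP, hQ, mulVec_zero, add_zero, one_smul, prodVec_add_right, prodVec_smul_right,
      mulVec_add, mulVec_smul, h0, smul_zero, zero_add, e, mulVec_mulVec,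
      conjTranspose_fromCols_eq_fromRows_conjTranspose, fromRows_mul, fromRows_mulVec, hR, hNM]
    simp
  · have e : C *ᵥ prodVec (S *ᵥ x) ψ = (N * S) *ᵥ x := by
      rw [← rSlice_swapFactors, mulVec_mulVec]
    rw [key, hP, hQ, mulVec_zero, add_zero, one_smul, prodVec_add_left, prodVec_smul_left,
      mulVec_add, mulVec_smul, h0, smul_zero, zero_add, e, mulVec_mulVec,
      conjTranspose_fromCols_eq_fromRows_conjTranspose, fromRows_mul, fromRows_mulVec, hS, hMN]
    simp

section Quintic

variable {S : Type*} [CommRing S]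

/-- The determinant of the `2 × 2` matrix with columns `u` and `v`. -/
def det₂ (u v : Fin 2 → S) : S := u 0 * v 1 - u 1 * v 0

/-- The bilinear map on `S²` with structure constants `a`. -/
def bilin (a : Fin 2 → Fin 2 → Fin 2 → S) (x y : Fin 2 → S) : Fin 2 → S :=
  fun k => ∑ i, ∑ j, a i j k * (x i * y j)

/-- The vector `x`, unique up to scaling for generic `y`, such that `y` is an eigenvector of
`bilin a x`. -/
def critVec (a : Fin 2 → Fin 2 → Fin 2 → S) (y : Fin 2 → S) : Fin 2 → S :=
  ![-det₂ (bilin a ![0, 1] y) y, det₂ (bilin a ![1, 0] y) y]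

/-- The quintic form vanishing at `y` if `critVec a y` is an eigenvector of `bilin b y`. -/
def quintic (a b : Fin 2 → Fin 2 → Fin 2 → S) (y : Fin 2 → S) : S :=
  det₂ (bilin b y (critVec a y)) (critVec a y)

theorem det₂_bilin (a : Fin 2 → Fin 2 → Fin 2 → S) (x y : Fin 2 → S) :
    det₂ (bilin a x y) y = det₂ x (critVec a y) := by
  simp [det₂, bilin, critVec, Fin.sum_univ_two]; ring

theorem det₂_self (x : Fin 2 → S) : det₂ x x = 0 := by
  simp [det₂, mul_comm]

theorem critVec_smul (a : Fin 2 → Fin 2 → Fin 2 → S) (c : S) (y : Fin 2 → S) :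
    critVec a (c • y) = c ^ 2 • critVec a y := by
  ext i
  fin_cases i <;> simp [det₂, bilin, critVec, Fin.sum_univ_two] <;> ring

theorem bilin_smul_left (a : Fin 2 → Fin 2 → Fin 2 → S) (c : S) (x y : Fin 2 → S) :
    bilin a (c • x) y = c • bilin a x y := by
  ext k
  simp [bilin, Fin.sum_univ_two]; ring

theorem bilin_smul_right (a : Fin 2 → Fin 2 → Fin 2 → S) (c : S) (x y : Fin 2 → S) :
    bilin a x (c • y) = c • bilin a x y := by
  ext k
  simp [bilin, Fin.sum_univ_two]; ring

theorem bilin_add_left (a : Fin 2 → Fin 2 → Fin 2 → S) (x x' y : Fin 2 → S) :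
    bilin a (x + x') y = bilin a x y + bilin a x' y := by
  ext k
  simp [bilin, Fin.sum_univ_two]; ring

theorem bilin_add_right (a : Fin 2 → Fin 2 → Fin 2 → S) (x y y' : Fin 2 → S) :
    bilin a x (y + y') = bilin a x y + bilin a x y' := by
  ext k
  simp [bilin, Fin.sum_univ_two]; ring

theorem quintic_smul (a b : Fin 2 → Fin 2 → Fin 2 → S) (c : S) (y : Fin 2 → S) :
    quintic a b (c • y) = c ^ 5 * quintic a b y := by
  simp only [quintic, critVec_smul, bilin_smul_left, bilin_smul_right]
  simp [det₂]; ring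

theorem exists_smul_of_det₂_eq_zero {x y : Fin 2 → ℂ} (hy : y ≠ 0) (h : det₂ x y = 0) :
    ∃ c : ℂ, x = c • y := by
  simp only [det₂] at h
  by_cases h0 : y 0 = 0
  · have h1 : y 1 ≠ 0 := fun h1 => hy (by ext i; fin_cases i <;> simp [h0, h1])
    refine ⟨x 1 / y 1, ?_⟩
    rw [h0, mul_zero, sub_zero] at h
    ext i
    fin_cases i
    · simpa [h0, h1] using h
    · simp [h1]
  · refine ⟨x 0 / y 0, ?_⟩
    ext i
    fin_cases i
    · simp [h0]
    · simp; field_simp; linear_combination -h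

theorem exists_eq_smul_add_smul {u v : Fin 2 → ℂ} (h : det₂ u v ≠ 0) (y : Fin 2 → ℂ) :
    ∃ c d : ℂ, y = c • u + d • v := by
  refine ⟨det₂ y v / det₂ u v, det₂ u y / det₂ u v, ?_⟩
  ext i
  simp only [Pi.add_apply, Pi.smul_apply, smul_eq_mul]
  field_simp
  fin_cases i <;> simp [det₂] <;> ring

open Polynomial

/-- The restriction of the quintic form to the affine line `u + t v`, as a polynomial in `t`. -/
noncomputable def quinticLine (a b : Fin 2 → Fin 2 → Fin 2 → ℂ) (u v : Fin 2 → ℂ) : ℂ[X] :=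
  quintic (fun i j k => C (a i j k)) (fun i j k => C (b i j k)) fun i => C (v i) * X + C (u i)

theorem eval_quinticLine (a b : Fin 2 → Fin 2 → Fin 2 → ℂ) (u v : Fin 2 → ℂ) (t : ℂ) :
    (quinticLine a b u v).eval t = quintic a b (u + t • v) := by
  simp [quinticLine, quintic, critVec, det₂, bilin, Fin.sum_univ_two]
  ring

/-- The derivative of `critVec a` at `y` in direction `v`. -/
def critVecDeriv (a : Fin 2 → Fin 2 → Fin 2 → S) (y v : Fin 2 → S) : Fin 2 → S :=
  ![-det₂ (bilin a ![0, 1] v) y - det₂ (bilin a ![0, 1] y) v,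
    det₂ (bilin a ![1, 0] v) y + det₂ (bilin a ![1, 0] y) v]

theorem eval_derivative_quinticLine (a b : Fin 2 → Fin 2 → Fin 2 → ℂ) (u v : Fin 2 → ℂ) (t : ℂ) :
    (derivative (quinticLine a b u v)).eval t =
      det₂ (bilin b v (critVec a (u + t • v)) + bilin b (u + t • v) (critVecDeriv a (u + t • v) v))
        (critVec a (u + t • v)) +
      det₂ (bilin b (u + t • v) (critVec a (u + t • v))) (critVecDeriv a (u + t • v) v) := by
  simp [quinticLine, quintic, critVec, critVecDeriv, det₂, bilin, Fin.sum_univ_two]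
  ring

theorem det₂_bilin_critVecDeriv (a : Fin 2 → Fin 2 → Fin 2 → S) (y v : Fin 2 → S) :
    det₂ (bilin a (critVecDeriv a y v) y + bilin a (critVec a y) v) y +
      det₂ (bilin a (critVec a y) y) v = 0 := by
  simp [critVec, critVecDeriv, det₂, bilin, Fin.sum_univ_two]
  ring

/-- `p` has degree at most `d`, with coefficient `c` in degree `d`. -/
def HasTopCoeff (d : ℕ) (p : ℂ[X]) (c : ℂ) : Prop := p.natDegree ≤ d ∧ p.coeff d = c

theorem HasTopCoeff.add {d : ℕ} {p q : ℂ[X]} {c c' : ℂ} (hp : HasTopCoeff d p c)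
    (hq : HasTopCoeff d q c') : HasTopCoeff d (p + q) (c + c') :=
  ⟨natDegree_add_le_of_degree_le hp.1 hq.1, by rw [coeff_add, hp.2, hq.2]⟩

theorem HasTopCoeff.neg {d : ℕ} {p : ℂ[X]} {c : ℂ} (hp : HasTopCoeff d p c) :
    HasTopCoeff d (-p) (-c) := ⟨by rw [natDegree_neg]; exact hp.1, by rw [coeff_neg, hp.2]⟩

theorem HasTopCoeff.mul {d e : ℕ} {p q : ℂ[X]} {c c' : ℂ} (hp : HasTopCoeff d p c)
    (hq : HasTopCoeff e q c') : HasTopCoeff (d + e) (p * q) (c * c') :=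
  ⟨natDegree_mul_le_of_le hp.1 hq.1, by rw [coeff_mul_add_eq_of_natDegree_le hp.1 hq.1, hp.2, hq.2]⟩

theorem HasTopCoeff.C_mul {d : ℕ} {p : ℂ[X]} {c : ℂ} (hp : HasTopCoeff d p c) (r : ℂ) :
    HasTopCoeff d (C r * p) (r * c) :=
  ⟨(natDegree_C_mul_le r p).trans hp.1, by rw [coeff_C_mul, hp.2]⟩

theorem HasTopCoeff.det₂ {d e : ℕ} {x y : Fin 2 → ℂ[X]} {x' y' : Fin 2 → ℂ}
    (hx : ∀ i, HasTopCoeff d (x i) (x' i)) (hy : ∀ i, HasTopCoeff e (y i) (y' i)) :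
    HasTopCoeff (d + e) (det₂ x y) (_root_.det₂ x' y') := by
  simp only [_root_.det₂, sub_eq_add_neg]
  exact ((hx 0).mul (hy 1)).add ((hx 1).mul (hy 0)).neg

theorem HasTopCoeff.bilin {d e : ℕ} {x y : Fin 2 → ℂ[X]} {x' y' : Fin 2 → ℂ}
    (a : Fin 2 → Fin 2 → Fin 2 → ℂ)
    (hx : ∀ i, HasTopCoeff d (x i) (x' i)) (hy : ∀ i, HasTopCoeff e (y i) (y' i)) (k : Fin 2) :
    HasTopCoeff (d + e) (bilin (fun i j k => C (a i j k)) x y k) (_root_.bilin a x' y' k) := by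
  simp only [_root_.bilin, Fin.sum_univ_two]
  have h := fun i j => ((hx i).mul (hy j)).C_mul (a i j k)
  exact ((h 0 0).add (h 0 1)).add ((h 1 0).add (h 1 1))

theorem HasTopCoeff.critVec {y : Fin 2 → ℂ[X]} {y' : Fin 2 → ℂ}
    (a : Fin 2 → Fin 2 → Fin 2 → ℂ) (hy : ∀ i, HasTopCoeff 1 (y i) (y' i)) (k : Fin 2) :
    HasTopCoeff 2 (critVec (fun i j k => C (a i j k)) y k) (_root_.critVec a y' k) := by
  have h : ∀ x : Fin 2 → ℂ, HasTopCoeff 2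
      (_root_.det₂ (_root_.bilin (fun i j k => C (a i j k)) (fun i => C (x i)) y) y)
      (_root_.det₂ (_root_.bilin a x y') y') := fun x =>
    .det₂ (d := 1) (e := 1) (.bilin (d := 0) (e := 1) a (fun i => ⟨by simp, by simp⟩) hy) hy
  have e0 : (fun i => C ((![0, 1] : Fin 2 → ℂ) i)) = (![0, 1] : Fin 2 → ℂ[X]) := by
    ext i : 1; fin_cases i <;> simp
  have e1 : (fun i => C ((![1, 0] : Fin 2 → ℂ) i)) = (![1, 0] : Fin 2 → ℂ[X]) := by
    ext i : 1; fin_cases i <;> simp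
  fin_cases k
  · have := (h ![0, 1]).neg
    rwa [e0] at this
  · have := h ![1, 0]
    rwa [e1] at this

theorem hasTopCoeff_quinticLine (a b : Fin 2 → Fin 2 → Fin 2 → ℂ) (u v : Fin 2 → ℂ) :
    HasTopCoeff 5 (quinticLine a b u v) (quintic a b v) := by
  have hy : ∀ i, HasTopCoeff 1 (C (v i) * X + C (u i)) (v i) := fun i =>
    ⟨natDegree_linear_le, by simp⟩
  exact .det₂ (d := 3) (e := 2) (.bilin (d := 1) (e := 2) b hy (.critVec a hy)) (.critVec a hy)

theorem card_roots_toFinset {p : ℂ[X]} {d : ℕ} {c : ℂ} (h : HasTopCoeff d p c) (hc : c ≠ 0)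
    (hd : ∀ t, p.eval t = 0 → (derivative p).eval t ≠ 0) : p.roots.toFinset.card = d := by
  have hp : p ≠ 0 := fun h0 => hc (by rw [← h.2, h0, coeff_zero])
  rw [Multiset.toFinset_card_of_nodup, IsAlgClosed.card_roots_eq_natDegree]
  · exact le_antisymm h.1 (le_natDegree_of_ne_zero (h.2.trans_ne hc))
  · rw [Multiset.nodup_iff_count_le_one]
    intro t
    rw [count_roots]
    by_contra! hlt
    obtain ⟨h1, h2⟩ := (one_lt_rootMultiplicity_iff_isRoot hp).1 hlt
    exact hd t h1 h2

end Quintic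

section NormalForm

/-- `C` is given in block form by the two bilinear maps `bilin a` and `bilin b`. -/
def IsNormalForm (C : Matrix (Fin 2 ⊕ Fin 2) (Fin 3 × Fin 3) ℂ)
    (a b : Fin 2 → Fin 2 → Fin 2 → ℂ) : Prop :=
  ∀ (s t : ℂ) (x y : Fin 2 → ℂ), C *ᵥ prodVec (vecCons s x) (vecCons t y) =
    Sum.elim (s • y + bilin a x y) (t • x + bilin b y x)

variable {C : Matrix (Fin 2 ⊕ Fin 2) (Fin 3 × Fin 3) ℂ}

theorem vecCons_eq_smul_add (s : ℂ) (x : Fin 2 → ℂ) :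
    (vecCons s x : Fin 3 → ℂ) = s • vecCons 1 0 + vecCons 0 x := by
  ext i
  refine Fin.cases ?_ (fun j => ?_) i <;> simp

theorem exists_isNormalForm
    (h1 : ∀ t y, C *ᵥ prodVec (vecCons 1 0) (vecCons t y) = Sum.elim y (0 : Fin 2 → ℂ))
    (h2 : ∀ s x, C *ᵥ prodVec (vecCons s x) (vecCons 1 0) = Sum.elim (0 : Fin 2 → ℂ) x) :
    ∃ a b, IsNormalForm C a b := by
  refine ⟨fun i j k => C (Sum.inl k) (i.succ, j.succ), fun j i k => C (Sum.inr k) (i.succ, j.succ),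
    fun s t x y => ?_⟩
  have e : C *ᵥ prodVec (vecCons 0 x) (vecCons 0 y) =
      Sum.elim (bilin (fun i j k => C (Sum.inl k) (i.succ, j.succ)) x y)
        (bilin (fun j i k => C (Sum.inr k) (i.succ, j.succ)) y x) := by
    ext i
    cases i with
    | inl i =>
      simp [mulVec, dotProduct, prodVec, Fintype.sum_prod_type, Fin.sum_univ_succ, bilin]
    | inr i =>
      simp [mulVec, dotProduct, prodVec, Fintype.sum_prod_type, Fin.sum_univ_succ, bilin]
      ring
  rw [vecCons_eq_smul_add s x, prodVec_add_left, mulVec_add, prodVec_smul_left, mulVec_smul, h1,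
    vecCons_eq_smul_add t y, prodVec_add_right, mulVec_add, prodVec_smul_right, mulVec_smul, h2, e]
  ext i
  cases i <;> simp

theorem vecCons_ne_zero {x : Fin 2 → ℂ} (hx : x ≠ 0) (s : ℂ) : (vecCons s x : Fin 3 → ℂ) ≠ 0 :=
  fun h => hx (by
    have := congrArg vecTail h
    simpa using this)

theorem vecCons_smul (c s : ℂ) (x : Fin 2 → ℂ) :
    (c • vecCons s x : Fin 3 → ℂ) = vecCons (c * s) (c • x) := by
  simp

variable {a b : Fin 2 → Fin 2 → Fin 2 → ℂ}

theorem IsNormalForm.mulVec_eq_zero (hN : IsNormalForm C a b) {x y : Fin 2 → ℂ} {l k : ℂ}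
    (hx : bilin a x y = l • y) (hy : bilin b y x = k • x) :
    C *ᵥ prodVec (vecCons (-l) x) (vecCons (-k) y) = 0 := by
  rw [hN, hx, hy]
  ext i
  cases i <;> simp

theorem IsNormalForm.deformation (hN : IsNormalForm C a b) (hC : PPT (Cᴴ * C))
    (hs : ¬Separable (Cᴴ * C)) {x y x' y' : Fin 2 → ℂ} {l k l' k' : ℂ} (hx0 : x ≠ 0) (hy0 : y ≠ 0)
    (hx : bilin a x y = l • y) (hy : bilin b y x = k • x)
    (hx' : bilin a x' y + bilin a x y' = l • y' + l' • y)
    (hy' : bilin b y' x + bilin b y x' = k • x' + k' • x) : ∃ c : ℂ, y' = c • y := by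
  have h0 := hN.mulVec_eq_zero hx hy
  have hsum : C *ᵥ prodVec (vecCons (-l) x) (vecCons (-k') y') +
      C *ᵥ prodVec (vecCons (-l') x') (vecCons (-k) y) = 0 := by
    rw [hN, hN]
    ext i
    cases i with
    | inl i => have := congrFun hx' i; simp at this ⊢; linear_combination this
    | inr i => have := congrFun hy' i; simp at this ⊢; linear_combination this
  have ho := hC.orthogonal h0 (vecCons (-l') x') (vecCons (-k') y')
  rw [eq_neg_of_add_eq_zero_right hsum, dotProduct_neg, neg_eq_zero,
    dotProduct_star_self_eq_zero] at ho
  obtain ⟨c, hc⟩ := (rank_rSlice hC hs (vecCons_ne_zero hx0 _) (vecCons_ne_zero hy0 _) h0).2 _ ho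
  exact ⟨c, by simpa using congrArg vecTail hc⟩

theorem exists_smul_of_orthogonal {v w z : Fin 2 → ℂ} (hv : v ≠ 0) (hw : w ≠ 0)
    (h1 : star v ⬝ᵥ w = 0) (h2 : star v ⬝ᵥ z = 0) : ∃ c : ℂ, z = c • w := by
  refine exists_smul_of_det₂_eq_zero hw ?_
  by_contra hd
  apply hv
  have h : ∀ q, star v ⬝ᵥ q = 0 := fun q => by
    obtain ⟨c, d, rfl⟩ := exists_eq_smul_add_smul hd q
    rw [dotProduct_add, dotProduct_smul, dotProduct_smul, h1, h2, smul_zero, smul_zero, add_zero]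
  exact dotProduct_star_self_eq_zero.1 (h v)

/-- A vector orthogonal to `v`, of the same length. -/
noncomputable def perp (v : Fin 2 → ℂ) : Fin 2 → ℂ := ![-conj (v 1), conj (v 0)]

theorem star_dotProduct_perp (v : Fin 2 → ℂ) : star v ⬝ᵥ perp v = 0 := by
  simp [perp, dotProduct, Fin.sum_univ_two]; ring

theorem star_perp_dotProduct (v : Fin 2 → ℂ) : star (perp v) ⬝ᵥ v = 0 := by
  simp [perp, dotProduct, Fin.sum_univ_two]; ring

theorem star_perp_dotProduct_perp (v : Fin 2 → ℂ) : star (perp v) ⬝ᵥ perp v = star v ⬝ᵥ v := by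
  simp [perp, dotProduct, Fin.sum_univ_two]; ring

theorem perp_ne_zero {v : Fin 2 → ℂ} (hv : v ≠ 0) : perp v ≠ 0 := fun h =>
  hv (dotProduct_star_self_eq_zero.1 (by rw [← star_perp_dotProduct_perp, h, dotProduct_zero]))

theorem det₂_perp_ne_zero {v : Fin 2 → ℂ} (hv : v ≠ 0) : det₂ (perp v) v ≠ 0 := by
  have e : det₂ (perp v) v = -(star v ⬝ᵥ v) := by
    simp [perp, det₂, dotProduct, Fin.sum_univ_two]; ring
  rw [e, neg_ne_zero]
  exact fun h => hv (dotProduct_star_self_eq_zero.1 h)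

theorem IsNormalForm.orthogonal_left (hN : IsNormalForm C a b) (hC : PPT (Cᴴ * C))
    {x y : Fin 2 → ℂ} {l k : ℂ} (hy0 : y ≠ 0)
    (hx : bilin a x y = l • y) (hy : bilin b y x = k • x) :
    ∃ c : ℂ, bilin a x (perp y) = c • perp y := by
  have ho := hC.orthogonal (hN.mulVec_eq_zero hx hy) (vecCons 1 0) (vecCons 0 (perp y))
  rw [hN, hN] at ho
  refine exists_smul_of_orthogonal hy0 (perp_ne_zero hy0) (star_dotProduct_perp y) ?_
  have h1 := star_dotProduct_perp y
  have h2 := star_perp_dotProduct y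
  simp [dotProduct, Fin.sum_univ_two, bilin] at ho h1 h2 ⊢
  have := congrArg conj ho
  simp at this
  linear_combination this + l * h1

theorem IsNormalForm.orthogonal_right (hN : IsNormalForm C a b) (hC : PPT (Cᴴ * C))
    {x y : Fin 2 → ℂ} {l k : ℂ} (hx0 : x ≠ 0)
    (hx : bilin a x y = l • y) (hy : bilin b y x = k • x) :
    ∃ c : ℂ, bilin b y (perp x) = c • perp x := by
  have ho := hC.orthogonal (hN.mulVec_eq_zero hx hy) (vecCons 0 (perp x)) (vecCons 1 0)
  rw [hN, hN] at ho
  refine exists_smul_of_orthogonal hx0 (perp_ne_zero hx0) (star_dotProduct_perp x) ?_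
  have h1 := star_dotProduct_perp x
  simp [dotProduct, Fin.sum_univ_two, bilin] at ho h1 ⊢
  linear_combination ho + k * h1

end NormalForm

section CommonEigenvector

variable {C : Matrix (Fin 2 ⊕ Fin 2) (Fin 3 × Fin 3) ℂ} {a b : Fin 2 → Fin 2 → Fin 2 → ℂ}

theorem exists_eigenvector_bilin (b : Fin 2 → Fin 2 → Fin 2 → ℂ) (y : Fin 2 → ℂ) :
    ∃ x ≠ 0, ∃ k : ℂ, bilin b y x = k • x := by
  let M : Matrix (Fin 2) (Fin 2) ℂ := of fun k j => ∑ i, b i j k * y i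
  obtain ⟨k, hk⟩ := Module.End.exists_eigenvalue (toLin' M)
  obtain ⟨x, hx, hx0⟩ := hk.exists_hasEigenvector
  refine ⟨x, hx0, k, ?_⟩
  rw [← Module.End.mem_eigenspace_iff.1 hx]
  ext i
  simp [M, mulVec, dotProduct, bilin, Fin.sum_univ_two]
  ring

theorem separable_of_common_eigenvectors (hN : IsNormalForm C a b) (hC : PPT (Cᴴ * C))
    {w : Fin 2 → Fin 2 → ℂ} (hw : ∀ k l, star (w k) ⬝ᵥ w l = if k = l then 1 else 0)
    (hw' : ∀ y, y = ∑ k, (star (w k) ⬝ᵥ y) • w k) {r : Fin 2 → Fin 2 → ℂ}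
    (ha : ∀ k x, bilin a x (w k) = (r k ⬝ᵥ x) • w k) : Separable (Cᴴ * C) := by
  refine separable_of_split allSep_two_three hC (φ := vecCons 1 0)
    (fun h => one_ne_zero (congrFun h 0)) (fun k => Sum.elim (w k) 0) (fun k => vecCons 0 (w k))
    (fun k => vecCons 0 (star (w k))) (fun k => vecCons 1 (r k)) (fun k l => ?_) (fun k => ?_)
    (fun k => ?_) (fun y => ?_) fun x y k => ?_
  · rw [← hw k l]
    simp [dotProduct]
  · rw [hN]
    ext i
    cases i <;> simp [bilin]
  · simp
  · obtain ⟨t, y, rfl⟩ : ∃ t y', y = vecCons t y' := ⟨_, _, (cons_head_tail y).symm⟩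
    rw [hN]
    ext i
    cases i with
    | inl i => simpa [bilin] using congrFun (hw' y) i
    | inr i => simp [bilin]
  · obtain ⟨t, y, rfl⟩ : ∃ t y', y = vecCons t y' := ⟨_, _, (cons_head_tail y).symm⟩
    obtain ⟨s, x, rfl⟩ : ∃ s x', x = vecCons s x' := ⟨_, _, (cons_head_tail x).symm⟩
    have e : star (w k) ⬝ᵥ bilin a x y = (r k ⬝ᵥ x) * (star (w k) ⬝ᵥ y) := by
      conv_lhs => rw [hw' y]
      rw [Fin.sum_univ_two, bilin_add_right, bilin_smul_right, bilin_smul_right, ha, ha,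
        dotProduct_add]
      simp only [dotProduct_smul, hw]
      fin_cases k <;> simp <;> ring
    have e' : star (Sum.elim (w k) (0 : Fin 2 → ℂ)) ⬝ᵥ
        Sum.elim (s • y + bilin a x y) (t • x + bilin b y x) =
        star (w k) ⬝ᵥ (s • y + bilin a x y) := by
      simp [dotProduct]
    rw [hN, e', dotProduct_add, e, dotProduct_smul]
    simp
    ring

theorem orthonormal_perp {v : Fin 2 → ℂ} (hv : star v ⬝ᵥ v = 1) (k l : Fin 2) :
    star ((![v, perp v] : Fin 2 → Fin 2 → ℂ) k) ⬝ᵥ (![v, perp v] : Fin 2 → Fin 2 → ℂ) l =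
      if k = l then 1 else 0 := by
  fin_cases k <;> fin_cases l
  · exact hv
  · exact star_dotProduct_perp v
  · exact star_perp_dotProduct v
  · exact (star_perp_dotProduct_perp v).trans hv

theorem eq_sum_perp {v : Fin 2 → ℂ} (hv : star v ⬝ᵥ v = 1) (z : Fin 2 → ℂ) :
    z = ∑ k, (star ((![v, perp v] : Fin 2 → Fin 2 → ℂ) k) ⬝ᵥ z) •
      (![v, perp v] : Fin 2 → Fin 2 → ℂ) k := by
  have hv0 : v ≠ 0 := fun h => by simp [h] at hv
  obtain ⟨p, q, rfl⟩ := exists_eq_smul_add_smul (det₂_perp_ne_zero hv0) z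
  rw [Fin.sum_univ_two, cons_val_zero, cons_val_one, cons_val_fin_one]
  simp only [dotProduct_add, dotProduct_smul, star_dotProduct_perp, star_perp_dotProduct,
    star_perp_dotProduct_perp, hv]
  module

theorem critVec_ne_zero (hN : IsNormalForm C a b) (hC : PPT (Cᴴ * C))
    (hs : ¬Separable (Cᴴ * C)) {y : Fin 2 → ℂ} (hy0 : y ≠ 0) : critVec a y ≠ 0 := by
  obtain ⟨r, hr0, hr⟩ := exists_normalization hy0
  suffices h : critVec a (r • y) ≠ 0 from fun h0 => h (by rw [critVec_smul, h0, smul_zero])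
  replace hy0 := smul_ne_zero hr0 hy0
  generalize r • y = v at hr hy0
  intro h0
  have hev : ∀ x, ∃ l : ℂ, bilin a x v = l • v := fun x =>
    exists_smul_of_det₂_eq_zero hy0 (by rw [det₂_bilin, h0]; simp [det₂])
  obtain ⟨x, hx0, k, hk⟩ := exists_eigenvector_bilin b v
  obtain ⟨l, hl⟩ := hev x
  obtain ⟨k', hk'⟩ := hN.orthogonal_right hC hx0 hl hk
  obtain ⟨l', hl'⟩ := hev (perp x)
  obtain ⟨c, hc⟩ := hN.orthogonal_left hC hy0 hl hk
  obtain ⟨c', hc'⟩ := hN.orthogonal_left hC hy0 hl' hk'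
  have hev' : ∀ z, ∃ c : ℂ, bilin a z (perp v) = c • perp v := fun z => by
    obtain ⟨p, q, rfl⟩ := exists_eq_smul_add_smul (det₂_perp_ne_zero hx0) z
    exact ⟨p * c' + q * c, by
      rw [bilin_add_left, bilin_smul_left, bilin_smul_left, hc, hc']; module⟩
  have hwx : ∀ k x, ∃ c : ℂ, bilin a x ((![v, perp v] : Fin 2 → Fin 2 → ℂ) k) =
      c • (![v, perp v] : Fin 2 → Fin 2 → ℂ) k := fun k x => by
    fin_cases k
    · exact hev x
    · exact hev' x
  choose f hf using hwx
  refine hs (separable_of_common_eigenvectors hN hC (orthonormal_perp hr) (eq_sum_perp hr)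
    (r := fun k => ![f k ![1, 0], f k ![0, 1]]) fun k z => ?_)
  have e : z = z 0 • ![1, 0] + z 1 • ![0, 1] := by
    ext i
    fin_cases i <;> simp
  conv_lhs => rw [e]
  rw [bilin_add_left, bilin_smul_left, bilin_smul_left, hf, hf]
  simp only [dotProduct, Fin.sum_univ_two, cons_val_zero, cons_val_one, cons_val_fin_one]
  module

end CommonEigenvector

section SixPoints

variable {C : Matrix (Fin 2 ⊕ Fin 2) (Fin 3 × Fin 3) ℂ} {a b : Fin 2 → Fin 2 → Fin 2 → ℂ}

open Polynomial (derivative)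

theorem exists_eigenvalues (hN : IsNormalForm C a b) (hC : PPT (Cᴴ * C))
    (hs : ¬Separable (Cᴴ * C)) {y : Fin 2 → ℂ} (hy0 : y ≠ 0) (h : quintic a b y = 0) :
    ∃ l k : ℂ, bilin a (critVec a y) y = l • y ∧ bilin b y (critVec a y) = k • critVec a y := by
  obtain ⟨l, hl⟩ := exists_smul_of_det₂_eq_zero (x := bilin a (critVec a y) y) hy0
    (by rw [det₂_bilin, det₂_self])
  obtain ⟨k, hk⟩ := exists_smul_of_det₂_eq_zero (critVec_ne_zero hN hC hs hy0) h
  exact ⟨l, k, hl, hk⟩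

theorem add_smul_ne_zero {u v : Fin 2 → ℂ} (huv : det₂ u v ≠ 0) (t : ℂ) : u + t • v ≠ 0 := by
  intro h
  apply huv
  rw [eq_neg_of_add_eq_zero_left h]
  simp [det₂]
  ring

theorem eval_derivative_quinticLine_ne_zero (hN : IsNormalForm C a b) (hC : PPT (Cᴴ * C))
    (hs : ¬Separable (Cᴴ * C)) {u v : Fin 2 → ℂ} (huv : det₂ u v ≠ 0) (t : ℂ)
    (h : (quinticLine a b u v).eval t = 0) : (derivative (quinticLine a b u v)).eval t ≠ 0 := by
  intro h'
  rw [eval_derivative_quinticLine] at h'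
  rw [eval_quinticLine] at h
  have hy0 := add_smul_ne_zero huv t
  have hdet : det₂ (u + t • v) v ≠ 0 := by
    convert huv using 1
    simp [det₂]
    ring
  generalize u + t • v = y at *
  obtain ⟨l, k, hl, hk⟩ := exists_eigenvalues hN hC hs hy0 h
  have hx0 := critVec_ne_zero hN hC hs hy0
  have hd := det₂_bilin_critVecDeriv a y v
  rw [hl] at hd
  rw [hk] at h'
  obtain ⟨l', hl'⟩ := exists_smul_of_det₂_eq_zero (x := bilin a (critVecDeriv a y v) y +
    bilin a (critVec a y) v - l • v) hy0 (by
      simp [det₂] at hd ⊢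
      linear_combination hd)
  obtain ⟨k', hk'⟩ := exists_smul_of_det₂_eq_zero (x := bilin b v (critVec a y) +
    bilin b y (critVecDeriv a y v) - k • critVecDeriv a y v) hx0 (by
      simp only [det₂, Pi.add_apply, Pi.sub_apply, Pi.smul_apply, smul_eq_mul] at h' ⊢
      linear_combination h')
  obtain ⟨c, rfl⟩ := hN.deformation hC hs (x' := critVecDeriv a y v) (y' := v) hx0 hy0 hl hk
    ((sub_eq_iff_eq_add'.1 hl')) (sub_eq_iff_eq_add'.1 hk')
  apply hdet
  simp [det₂]
  ring

theorem exists_quintic_ne_zero (hN : IsNormalForm C a b) (hC : PPT (Cᴴ * C))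
    (hs : ¬Separable (Cᴴ * C)) : ∃ v, quintic a b v ≠ 0 := by
  by_contra! h
  have huv : det₂ ![1, 0] (![0, 1] : Fin 2 → ℂ) ≠ 0 := by simp [det₂]
  have h0 : quinticLine a b ![1, 0] ![0, 1] = 0 := Polynomial.funext fun t => by
    rw [eval_quinticLine, h, Polynomial.eval_zero]
  refine eval_derivative_quinticLine_ne_zero hN hC hs huv 0 ?_ ?_ <;> simp [h0]

theorem exists_smul_of_prodVec_eq_smul {φ φ' : Fin n → ℂ} {ψ ψ' : Fin m → ℂ} {c : ℂ} (hφ : φ ≠ 0)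
    (h : prodVec φ ψ = c • prodVec φ' ψ') : ∃ d : ℂ, ψ = d • ψ' := by
  obtain ⟨i, hi⟩ := Function.ne_iff.1 hφ
  rw [Pi.zero_apply] at hi
  refine ⟨c * φ' i / φ i, ?_⟩
  ext j
  have := congrFun h (i, j)
  simp only [prodVec, Pi.smul_apply, smul_eq_mul] at this ⊢
  field_simp
  linear_combination this

theorem bilin_zero_left (a : Fin 2 → Fin 2 → Fin 2 → ℂ) (y : Fin 2 → ℂ) : bilin a 0 y = 0 := by
  simpa using bilin_smul_left a 0 0 y

theorem sixKernelProducts_of_isNormalForm (hN : IsNormalForm C a b) (hC : PPT (Cᴴ * C))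
    (hs : ¬Separable (Cᴴ * C)) : SixKernelProducts C := by
  obtain ⟨v, hv⟩ := exists_quintic_ne_zero hN hC hs
  have hv0 : v ≠ 0 := fun h => hv <| by
    rw [h, ← zero_smul ℂ (0 : Fin 2 → ℂ), quintic_smul]
    simp
  have huv := det₂_perp_ne_zero hv0
  generalize perp v = u at huv
  obtain ⟨r, hr, hroot⟩ : ∃ r : Fin 5 → ℂ, Function.Injective r ∧
      ∀ t, quintic a b (u + t • v) = 0 ↔ ∃ i, r i = t := by
    have htop := hasTopCoeff_quinticLine a b u v
    have hcard := card_roots_toFinset htop hv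
      (eval_derivative_quinticLine_ne_zero hN hC hs huv)
    refine ⟨_, Subtype.val_injective.comp (Finset.equivFinOfCardEq hcard).symm.injective,
      fun t => ?_⟩
    have h0 : quinticLine a b u v ≠ 0 := fun h0 => hv (by rw [← htop.2, h0, Polynomial.coeff_zero])
    rw [← eval_quinticLine, ← Polynomial.IsRoot.def, ← Polynomial.mem_roots h0,
      ← Multiset.mem_toFinset]
    refine ⟨fun h => ⟨Finset.equivFinOfCardEq hcard ⟨t, h⟩, by simp⟩, ?_⟩
    rintro ⟨i, rfl⟩
    exact Subtype.coe_prop _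
  have hy0 := fun i => add_smul_ne_zero huv (r i)
  have hx0 := fun i => critVec_ne_zero hN hC hs (hy0 i)
  choose l k hl hk using fun i => exists_eigenvalues hN hC hs (hy0 i) ((hroot _).2 ⟨i, rfl⟩)
  let y : Fin 5 → Fin 2 → ℂ := fun i => u + r i • v
  have hl : ∀ i, bilin a (critVec a (y i)) (y i) = l i • y i := hl
  have hk : ∀ i, bilin b (y i) (critVec a (y i)) = k i • critVec a (y i) := hk
  have h10 : (vecCons 1 0 : Fin 3 → ℂ) ≠ 0 := fun h => one_ne_zero (congrFun h 0)
  let Φ : Fin 6 → Fin 3 → ℂ := Fin.cons (vecCons 1 0) fun i => vecCons (-l i) (critVec a (y i))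
  let Ψ : Fin 6 → Fin 3 → ℂ := Fin.cons (vecCons 1 0) fun i => vecCons (-k i) (y i)
  have hΦΨ : ∀ t, Φ t ≠ 0 ∧ Ψ t ≠ 0 ∧ C *ᵥ prodVec (Φ t) (Ψ t) = 0 := fun t => by
    refine Fin.cases ⟨h10, h10, ?_⟩ (fun i => ⟨vecCons_ne_zero (hx0 i) _,
      vecCons_ne_zero (hy0 i) _, hN.mulVec_eq_zero (hl i) (hk i)⟩) t
    change C *ᵥ prodVec (vecCons 1 0) (vecCons 1 0) = 0
    rw [hN]
    ext i
    cases i <;> simp [bilin]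
  refine ⟨Φ, Ψ, hΦΨ, fun t t' htt c hc => ?_, fun φ ψ hφ hψ h0 => ?_⟩
  · obtain ⟨d, hd⟩ := exists_smul_of_prodVec_eq_smul (hΦΨ t).1 hc
    clear hc
    induction t using Fin.cases with
    | zero =>
      induction t' using Fin.cases with
      | zero => exact htt rfl
      | succ j =>
        have hd : vecCons 1 0 = d • vecCons (-k j) (y j) := hd
        rw [vecCons_smul] at hd
        have h1 := congrArg vecTail hd
        have h2 := congrFun hd 0
        simp only [tail_cons] at h1
        simp [(smul_eq_zero.1 h1.symm).resolve_right (hy0 j)] at h2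
    | succ i =>
      induction t' using Fin.cases with
      | zero =>
        have hd : vecCons (-k i) (y i) = d • vecCons 1 0 := hd
        rw [vecCons_smul] at hd
        have h1 := congrArg vecTail hd
        simp only [tail_cons, smul_zero] at h1
        exact hy0 i h1
      | succ j =>
        have hd : vecCons (-k i) (y i) = d • vecCons (-k j) (y j) := hd
        rw [vecCons_smul] at hd
        have h1 := congrArg vecTail hd
        simp only [tail_cons, y] at h1
        have e1 : det₂ u v = d * det₂ u v := by
          have := congrArg (fun z => det₂ z v) h1
          simp [det₂] at this ⊢
          linear_combination this
        have e2 : r i * det₂ u v = d * r j * det₂ u v := by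
          have := congrArg (fun z => det₂ u z) h1
          simp only [det₂, Pi.add_apply, Pi.smul_apply, smul_eq_mul] at this ⊢
          linear_combination this
        have hd1 : d = 1 := mul_right_cancel₀ huv (by rw [← e1, one_mul])
        rw [hd1, one_mul] at e2
        exact htt (congrArg Fin.succ (hr (mul_right_cancel₀ huv e2)))
  · obtain ⟨s, x, rfl⟩ : ∃ s x, φ = vecCons s x := ⟨_, _, (cons_head_tail φ).symm⟩
    obtain ⟨t, z, rfl⟩ : ∃ t z, ψ = vecCons t z := ⟨_, _, (cons_head_tail ψ).symm⟩
    rw [hN] at h0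
    have hxz : s • z + bilin a x z = 0 := funext fun i => congrFun h0 (Sum.inl i)
    have hzx : t • x + bilin b z x = 0 := funext fun i => congrFun h0 (Sum.inr i)
    have hbase : x = 0 → z = 0 → ∃ (i : Fin 6) (c : ℂ),
        prodVec (vecCons s x) (vecCons t z) = c • prodVec (Φ i) (Ψ i) := by
      rintro rfl rfl
      refine ⟨0, s * t, ?_⟩
      change _ = _ • prodVec (vecCons 1 0) (vecCons 1 0)
      have e : ∀ s : ℂ, (vecCons s 0 : Fin 3 → ℂ) = s • vecCons 1 0 := fun s => by simp
      rw [e s, e t, prodVec_smul_left, prodVec_smul_right, smul_smul]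
    by_cases hx : x = 0
    · refine hbase hx ?_
      subst hx
      have hs0 : s ≠ 0 := fun h => hφ (by simp [h])
      rw [bilin_zero_left, add_zero] at hxz
      exact (smul_eq_zero.1 hxz).resolve_left hs0
    by_cases hz : z = 0
    · refine hbase ?_ hz
      subst hz
      have ht0 : t ≠ 0 := fun h => hψ (by simp [h])
      rw [bilin_zero_left, add_zero] at hzx
      exact (smul_eq_zero.1 hzx).resolve_left ht0
    obtain ⟨c, rfl⟩ := exists_smul_of_det₂_eq_zero (x := x) (critVec_ne_zero hN hC hs hz) (by
      rw [← det₂_bilin, eq_neg_of_add_eq_zero_right hxz]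
      simp [det₂]
      ring)
    have hc0 : c ≠ 0 := fun h => hx (by rw [h, zero_smul])
    have hqz : quintic a b z = 0 := by
      rw [bilin_smul_right, smul_comm, ← smul_add] at hzx
      rw [quintic, eq_neg_of_add_eq_zero_right ((smul_eq_zero.1 hzx).resolve_left hc0)]
      simp [det₂]
      ring
    obtain ⟨p, i, hp0, rfl⟩ : ∃ (p : ℂ) (i : Fin 5), p ≠ 0 ∧ z = p • y i := by
      obtain ⟨p, q, hpq⟩ := exists_eq_smul_add_smul huv z
      have hp0 : p ≠ 0 := by
        rintro rfl
        rw [zero_smul, zero_add] at hpq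
        rw [hpq, quintic_smul, mul_eq_zero, or_iff_left hv] at hqz
        exact hz (by rw [hpq, eq_zero_of_pow_eq_zero hqz, zero_smul])
      have hpq' : z = p • (u + (q / p) • v) := by
        rw [smul_add, smul_smul, mul_div_cancel₀ _ hp0, hpq]
      rw [hpq', quintic_smul, mul_eq_zero, or_iff_right (pow_ne_zero 5 hp0), hroot] at hqz
      obtain ⟨i, hi⟩ := hqz
      exact ⟨p, i, hp0, by rw [hpq', ← hi]⟩
    have hse : s = -(c * p ^ 2 * l i) := by
      rw [critVec_smul, bilin_smul_right, bilin_smul_left, bilin_smul_left, hl, smul_comm s,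
        ← smul_add, smul_eq_zero_iff_right hp0, smul_smul, smul_smul, ← add_smul] at hxz
      exact eq_neg_of_add_eq_zero_left ((smul_eq_zero.1 hxz).resolve_right (hy0 i))
    have hte : t = -(k i * p) := by
      rw [critVec_smul, bilin_smul_right, bilin_smul_left, bilin_smul_right, hk, smul_comm t,
        smul_comm p, ← smul_add, smul_eq_zero_iff_right hc0, smul_comm t, smul_comm p, ← smul_add,
        smul_eq_zero_iff_right (pow_ne_zero 2 hp0), smul_smul, ← add_smul] at hzx
      exact eq_neg_of_add_eq_zero_left ((smul_eq_zero.1 hzx).resolve_right (hx0 i))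
    refine ⟨i.succ, c * p ^ 2 * p, ?_⟩
    change _ = _ • prodVec (vecCons (-l i) (critVec a (y i))) (vecCons (-k i) (y i))
    rw [← smul_smul, ← prodVec_smul_right, ← prodVec_smul_left, vecCons_smul, vecCons_smul,
      critVec_smul, smul_smul, hse, hte, mul_neg, mul_neg,
      mul_comm p (k i)]

end SixPoints

theorem sixKernelProducts {C : Matrix (Fin 4) (Fin 3 × Fin 3) ℂ} (hC : PPT (Cᴴ * C))
    (hs : ¬Separable (Cᴴ * C)) : SixKernelProducts C := by
  obtain ⟨O, P, Q, P', Q', hO, hP, hQ, h1, h2⟩ := exists_normalForm hC hs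
  obtain ⟨a, b, hN⟩ := exists_isNormalForm h1 h2
  exact .of_congr hO hP hQ (sixKernelProducts_of_isNormalForm hN (hC.congr_mul hO)
    fun h => hs (separable_of_congr hO hP hQ h))

end

theorem stmt8 (ρ : Matrix (Fin 3 × Fin 3) (Fin 3 × Fin 3) ℂ)
    (hne : ρ ≠ 0) (hpsd : ρ.PosSemidef) (hppt : (pt ρ).PosSemidef)
    (hrank : ρ.rank = 4) (hsep : ¬ Separable ρ) :
    ∃ z : Fin 6 → (Fin 3 × Fin 3 → ℂ),
      (∀ t, z t ≠ 0 ∧ IsProd (z t) ∧ ρ.mulVec (z t) = 0) ∧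
      (∀ t t', t ≠ t' → ∀ c : ℂ, z t ≠ c • z t') ∧
      (∀ w : Fin 3 × Fin 3 → ℂ, w ≠ 0 → IsProd w → ρ.mulVec w = 0 →
        ∃ (t : Fin 6) (c : ℂ), w = c • z t) := by
  obtain ⟨C, -, rfl, -⟩ := hpsd.exists_factorization_of_rank_eq hrank
  obtain ⟨Φ, Ψ, h1, h2, h3⟩ := sixKernelProducts ⟨hpsd, hppt⟩ hsep
  refine ⟨fun t => prodVec (Φ t) (Ψ t), fun t => ⟨prodVec_ne_zero (h1 t).1 (h1 t).2.1,
    ⟨_, _, rfl⟩, (Matrix.conjTranspose_mul_self_mulVec_eq_zero C _).2 (h1 t).2.2⟩, h2, ?_⟩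
  rintro w hw ⟨φ, ψ, rfl⟩ h0
  refine h3 φ ψ ?_ ?_ ((Matrix.conjTranspose_mul_self_mulVec_eq_zero C _).1 h0)
  · rintro rfl
    exact hw (by ext; simp [prodVec])
  · rintro rfl
    exact hw (by ext; simp [prodVec])
end
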